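/- arXiv:2203.10864 — 7 statements merged into one kernel-verified Lean document; each statement's English description precedes it below -/
import Mathlib

section
/- For every dimension d ∈ ℕ there exists a constant c > 0 (depending only on d) with the following property: for every instance (k,X,Ω,E,K) of weight-constrained Euclidean least-squares clustering in ℝ^d (i.e., every A_i is the d×d identity matrix) and every ε ∈ (0,1/2], there exists an ε-coreset (X̃,Ω̃) for (k,X,Ω,E,K) whose number of points ñ satisfies ñ ≤ c·k²/ε^{d+1}. -/
open Finset Matrix

noncomputable section

/-- Squared anisotropic (ellipsoidal) norm `‖v‖_A² = vᵀ A v`. -/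
def anormSq {d : ℕ} (A : Matrix (Fin d) (Fin d) ℝ) (v : Fin d → ℝ) : ℝ :=
  v ⬝ᵥ A.mulVec v

/-- `ξ` is a (fractional) `k`-clustering of `n` points. -/
def IsClustering {k n : ℕ} (ξ : Fin k → Fin n → ℝ) : Prop :=
  (∀ i j, 0 ≤ ξ i j) ∧ ∀ j, ∑ i, ξ i j = 1

/-- The weight `ω(C_i)` of the `i`-th cluster. -/
def clusterWeight {k n : ℕ} (ω : Fin n → ℝ) (ξ : Fin k → Fin n → ℝ) (i : Fin k) : ℝ :=
  ∑ j, ξ i j * ω j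

/-- `ξ` is a weight-constrained `k`-clustering (an element of `C_K(k,X,Ω)`). -/
def IsWCC {k n : ℕ} (κlo κhi : Fin k → ℝ) (ω : Fin n → ℝ) (ξ : Fin k → Fin n → ℝ) : Prop :=
  IsClustering ξ ∧ ∀ i, κlo i ≤ clusterWeight ω ξ i ∧ clusterWeight ω ξ i ≤ κhi i

/-- `cost_{A,K}(X,C,S)`. -/
def cost {d k n : ℕ} (A : Fin k → Matrix (Fin d) (Fin d) ℝ)
    (x : Fin n → Fin d → ℝ) (ω : Fin n → ℝ) (ξ : Fin k → Fin n → ℝ)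
    (s : Fin k → Fin d → ℝ) : ℝ :=
  ∑ i, ∑ j, ξ i j * ω j * anormSq (A i) (x j - s i)

/-- `cost_{A,K}(X,S)`: optimal constrained assignment cost for fixed sites `s`. -/
def assignCost {d k n : ℕ} (κlo κhi : Fin k → ℝ) (A : Fin k → Matrix (Fin d) (Fin d) ℝ)
    (x : Fin n → Fin d → ℝ) (ω : Fin n → ℝ) (s : Fin k → Fin d → ℝ) : ℝ :=
  sInf {c : ℝ | ∃ ξ, IsWCC κlo κhi ω ξ ∧ c = cost A x ω ξ s}

/-- `cost_{A,K}(X,C)`: infimum over site tuples. -/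
def clusterCost {d k n : ℕ} (A : Fin k → Matrix (Fin d) (Fin d) ℝ)
    (x : Fin n → Fin d → ℝ) (ω : Fin n → ℝ) (ξ : Fin k → Fin n → ℝ) : ℝ :=
  sInf {c : ℝ | ∃ s : Fin k → Fin d → ℝ, c = cost A x ω ξ s}

/-- `OPT_{A,K}(X)`. -/
def OPTc {d k n : ℕ} (κlo κhi : Fin k → ℝ) (A : Fin k → Matrix (Fin d) (Fin d) ℝ)
    (x : Fin n → Fin d → ℝ) (ω : Fin n → ℝ) : ℝ :=
  sInf {c : ℝ | ∃ ξ, IsWCC κlo κhi ω ξ ∧ c = clusterCost A x ω ξ}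

/-- Unconstrained optimum `OPT_A(X)` (over all clusterings and all site tuples). -/
def OPTu {d k n : ℕ} (A : Fin k → Matrix (Fin d) (Fin d) ℝ)
    (x : Fin n → Fin d → ℝ) (ω : Fin n → ℝ) : ℝ :=
  sInf {c : ℝ | ∃ ξ, ∃ s : Fin k → Fin d → ℝ, IsClustering ξ ∧ c = cost A x ω ξ s}

/-- `(X',Ω')` is an `(ε,δ)`-coreset for `(k,X,Ω,A,K)`, witnessed by the extension `f`
and the offsets `Δp`, `Δm`. -/
def IsCoresetWith {d k n m : ℕ} (ε δ : ℝ) (κlo κhi : Fin k → ℝ)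
    (A : Fin k → Matrix (Fin d) (Fin d) ℝ)
    (x : Fin n → Fin d → ℝ) (ω : Fin n → ℝ)
    (x' : Fin m → Fin d → ℝ) (ω' : Fin m → ℝ)
    (f : (Fin k → Fin m → ℝ) → (Fin k → Fin n → ℝ)) (Δp Δm : ℝ) : Prop :=
  0 ≤ Δp ∧ Δp ≤ δ * Δm ∧
  (∀ ξ', IsWCC κlo κhi ω' ξ' → IsWCC κlo κhi ω (f ξ')) ∧
  ∀ (s : Fin k → Fin d → ℝ) (ξ' : Fin k → Fin m → ℝ), IsWCC κlo κhi ω' ξ' →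
    (1 - ε) * cost A x ω (f ξ') s ≤ cost A x' ω' ξ' s + Δp ∧
    assignCost κlo κhi A x' ω' s + Δm ≤ (1 + ε) * assignCost κlo κhi A x ω s


/-- Squared Euclidean norm of a coordinate vector. -/
def sqNorm {d : ℕ} (v : Fin d → ℝ) : ℝ := ∑ l, v l ^ 2

lemma sqNorm_nonneg {d : ℕ} (v : Fin d → ℝ) : 0 ≤ sqNorm v :=
  Finset.sum_nonneg fun _ _ => sq_nonneg _

lemma sqNorm_sub_comm {d : ℕ} (v w : Fin d → ℝ) : sqNorm (v - w) = sqNorm (w - v) := by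
  unfold sqNorm
  refine Finset.sum_congr rfl fun l _ => ?_
  simp only [Pi.sub_apply]
  ring

lemma anormSq_one {d : ℕ} (v : Fin d → ℝ) :
    anormSq (1 : Matrix (Fin d) (Fin d) ℝ) v = sqNorm v := by
  simp [anormSq, sqNorm, dotProduct, pow_two]

/-- The relaxed triangle inequality for squared distances. -/
lemma sqNorm_sub_le {d : ℕ} {δ : ℝ} (hδ : 0 < δ) (u v w : Fin d → ℝ) :
    sqNorm (u - w) ≤ (1 + δ) * sqNorm (v - w) + (1 + 1 / δ) * sqNorm (u - v) := by
  unfold sqNorm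
  rw [Finset.mul_sum, Finset.mul_sum, ← Finset.sum_add_distrib]
  refine Finset.sum_le_sum fun l _ => ?_
  simp only [Pi.sub_apply]
  have key : (1 + δ) * (v l - w l) ^ 2 + (1 + 1 / δ) * (u l - v l) ^ 2 - (u l - w l) ^ 2
      = (δ * (v l - w l) - (u l - v l)) ^ 2 / δ := by
    field_simp
    ring
  have : 0 ≤ (δ * (v l - w l) - (u l - v l)) ^ 2 / δ := by positivity
  linarith

lemma cost_one_eq {d k n : ℕ} (x : Fin n → Fin d → ℝ) (ω : Fin n → ℝ) (ξ : Fin k → Fin n → ℝ)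
    (s : Fin k → Fin d → ℝ) :
    cost (fun _ : Fin k => (1 : Matrix (Fin d) (Fin d) ℝ)) x ω ξ s
      = ∑ j, ω j * ∑ i, ξ i j * sqNorm (x j - s i) := by
  unfold cost
  rw [Finset.sum_comm]
  refine Finset.sum_congr rfl fun j _ => ?_
  rw [Finset.mul_sum]
  refine Finset.sum_congr rfl fun i _ => ?_
  rw [anormSq_one]
  ring

lemma cost_one_nonneg {d k n : ℕ} (x : Fin n → Fin d → ℝ) {ω : Fin n → ℝ} (hω : ∀ j, 0 < ω j)
    {ξ : Fin k → Fin n → ℝ} (hξ : IsClustering ξ) (s : Fin k → Fin d → ℝ) :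
    0 ≤ cost (fun _ : Fin k => (1 : Matrix (Fin d) (Fin d) ℝ)) x ω ξ s := by
  rw [cost_one_eq]
  exact Finset.sum_nonneg fun j _ => mul_nonneg (hω j).le <| Finset.sum_nonneg fun i _ =>
    mul_nonneg (hξ.1 i j) (sqNorm_nonneg _)

/-- Moving every point changes the cost of a clustering in a controlled way. -/
lemma cost_one_move_le {d k n : ℕ} (x p : Fin n → Fin d → ℝ) {ω : Fin n → ℝ}
    (hω : ∀ j, 0 < ω j) {ξ : Fin k → Fin n → ℝ} (hξ : IsClustering ξ) (s : Fin k → Fin d → ℝ)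
    {δ : ℝ} (hδ : 0 < δ) :
    cost (fun _ : Fin k => (1 : Matrix (Fin d) (Fin d) ℝ)) x ω ξ s
      ≤ (1 + δ) * cost (fun _ : Fin k => (1 : Matrix (Fin d) (Fin d) ℝ)) p ω ξ s
        + (1 + 1 / δ) * ∑ j, ω j * sqNorm (x j - p j) := by
  rw [cost_one_eq, cost_one_eq, Finset.mul_sum, Finset.mul_sum, ← Finset.sum_add_distrib]
  refine Finset.sum_le_sum fun j _ => ?_
  have h : ∑ i, ξ i j * sqNorm (x j - s i) ≤ ∑ i, ξ i j * ((1 + δ) * sqNorm (p j - s i)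
      + (1 + 1 / δ) * sqNorm (x j - p j)) :=
    Finset.sum_le_sum fun i _ => mul_le_mul_of_nonneg_left (sqNorm_sub_le hδ _ _ _) (hξ.1 i j)
  have h2 : ∑ i, ξ i j * ((1 + δ) * sqNorm (p j - s i) + (1 + 1 / δ) * sqNorm (x j - p j))
      = (1 + δ) * ∑ i, ξ i j * sqNorm (p j - s i) + (1 + 1 / δ) * sqNorm (x j - p j) := by
    simp only [mul_add, Finset.sum_add_distrib]
    rw [← Finset.sum_mul, hξ.2 j, one_mul, Finset.mul_sum]
    congr 1
    exact Finset.sum_congr rfl fun i _ => by ring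
  calc ω j * ∑ i, ξ i j * sqNorm (x j - s i)
      ≤ ω j * ((1 + δ) * ∑ i, ξ i j * sqNorm (p j - s i)
        + (1 + 1 / δ) * sqNorm (x j - p j)) :=
        mul_le_mul_of_nonneg_left (h.trans h2.le) (hω j).le
    _ = _ := by ring

section Batch

variable {ι : Type*} {d : ℕ}

/-- The weighted centroid of the points indexed by `B`. -/
def centroidOn (ω : ι → ℝ) (x : ι → Fin d → ℝ) (B : Finset ι) : Fin d → ℝ :=
  fun l => (∑ j ∈ B, ω j * x j l) / ∑ j ∈ B, ω j

/-- The weighted sum of squared distances of the points indexed by `B` to their centroid. -/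
def scatter (ω : ι → ℝ) (x : ι → Fin d → ℝ) (B : Finset ι) : ℝ :=
  ∑ j ∈ B, ω j * sqNorm (x j - centroidOn ω x B)

lemma sum_sqNorm_sub_eq {ω : ι → ℝ} (hω : ∀ j, 0 < ω j) (x : ι → Fin d → ℝ) (B : Finset ι)
    (s : Fin d → ℝ) :
    ∑ j ∈ B, ω j * sqNorm (x j - s)
      = scatter ω x B + (∑ j ∈ B, ω j) * sqNorm (centroidOn ω x B - s) := by
  rcases B.eq_empty_or_nonempty with rfl | hB
  · simp [scatter]
  have hW : 0 < ∑ j ∈ B, ω j := Finset.sum_pos (fun j _ => hω j) hB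
  have hc : ∀ l, ∑ j ∈ B, ω j * x j l = (∑ j ∈ B, ω j) * centroidOn ω x B l := fun l => by
    unfold centroidOn
    field_simp
  unfold scatter sqNorm
  simp only [Finset.mul_sum]
  rw [Finset.sum_comm, Finset.sum_comm (s := B), ← Finset.sum_add_distrib]
  refine Finset.sum_congr rfl fun l _ => ?_
  simp only [Pi.sub_apply]
  set c := centroidOn ω x B l
  have e : ∀ j ∈ B, ω j * (x j l - s l) ^ 2
      = ω j * (x j l - c) ^ 2 + (ω j * x j l * (2 * (c - s l)) + ω j * (s l ^ 2 - c ^ 2)) :=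
    fun j _ => by ring
  rw [Finset.sum_congr rfl e, Finset.sum_add_distrib, Finset.sum_add_distrib, ← Finset.sum_mul,
    ← Finset.sum_mul, hc l]
  ring

lemma scatter_le {ω : ι → ℝ} (hω : ∀ j, 0 < ω j) (x : ι → Fin d → ℝ) (B : Finset ι)
    (s : Fin d → ℝ) : scatter ω x B ≤ ∑ j ∈ B, ω j * sqNorm (x j - s) := by
  rw [sum_sqNorm_sub_eq hω]
  have := mul_nonneg (Finset.sum_nonneg fun j (_ : j ∈ B) => (hω j).le)
    (sqNorm_nonneg (centroidOn ω x B - s))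
  linarith

lemma scatter_nonneg {ω : ι → ℝ} (hω : ∀ j, 0 < ω j) (x : ι → Fin d → ℝ) (B : Finset ι) :
    0 ≤ scatter ω x B :=
  Finset.sum_nonneg fun j _ => mul_nonneg (hω j).le (sqNorm_nonneg _)

@[simp] lemma scatter_empty (ω : ι → ℝ) (x : ι → Fin d → ℝ) : scatter ω x ∅ = 0 := by
  simp [scatter]

lemma scatter_singleton {ω : ι → ℝ} (hω : ∀ j, 0 < ω j) (x : ι → Fin d → ℝ) (a : ι) :
    scatter ω x {a} = 0 := by
  refine le_antisymm ((scatter_le hω x {a} (x a)).trans ?_) (scatter_nonneg hω x _)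
  simp [sqNorm]

/-- Replacing an assignment on a batch by its average costs at most a relative `δ` plus a
multiple of the scatter of the batch. -/
lemma batch_average_cost_le {k : ℕ} {ω : ι → ℝ} (hω : ∀ j, 0 < ω j) (p : ι → Fin d → ℝ)
    (B : Finset ι) {ξ : Fin k → ι → ℝ} (hξ : ∀ i j, 0 ≤ ξ i j) (hξ1 : ∀ j ∈ B, ∑ i, ξ i j = 1)
    (s : Fin k → Fin d → ℝ) {δ : ℝ} (hδ : 0 < δ) :
    ∑ j ∈ B, ω j * ∑ i, (∑ j' ∈ B, ξ i j' * ω j') / (∑ j' ∈ B, ω j') * sqNorm (p j - s i)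
      ≤ (1 + δ) * ∑ j ∈ B, ω j * ∑ i, ξ i j * sqNorm (p j - s i)
        + (2 + 1 / δ) * scatter ω p B := by
  rcases B.eq_empty_or_nonempty with rfl | hB
  · simp
  have hW : 0 < ∑ j ∈ B, ω j := Finset.sum_pos (fun j _ => hω j) hB
  set W := ∑ j ∈ B, ω j
  set c := centroidOn ω p B with hc
  have hsum : ∑ i, (∑ j' ∈ B, ξ i j' * ω j') / W = 1 := by
    rw [← Finset.sum_div, Finset.sum_comm, div_eq_one_iff_eq hW.ne']
    refine Finset.sum_congr rfl fun j hj => ?_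
    rw [← Finset.sum_mul, hξ1 j hj, one_mul]
  have h1 : ∑ j ∈ B, ω j * ∑ i, (∑ j' ∈ B, ξ i j' * ω j') / W * sqNorm (p j - s i)
      = scatter ω p B + ∑ j ∈ B, ω j * ∑ i, ξ i j * sqNorm (c - s i) := by
    calc ∑ j ∈ B, ω j * ∑ i, (∑ j' ∈ B, ξ i j' * ω j') / W * sqNorm (p j - s i)
        = ∑ i, (∑ j' ∈ B, ξ i j' * ω j') / W * ∑ j ∈ B, ω j * sqNorm (p j - s i) := by
          simp only [Finset.mul_sum]
          rw [Finset.sum_comm]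
          exact Finset.sum_congr rfl fun i _ => Finset.sum_congr rfl fun j _ => by ring
      _ = ∑ i, ((∑ j' ∈ B, ξ i j' * ω j') / W * scatter ω p B
            + (∑ j' ∈ B, ξ i j' * ω j') * sqNorm (c - s i)) := by
          refine Finset.sum_congr rfl fun i _ => ?_
          rw [sum_sqNorm_sub_eq hω]
          field_simp
          rfl
      _ = _ := by
          rw [Finset.sum_add_distrib, ← Finset.sum_mul, hsum, one_mul]
          congr 1
          simp only [Finset.mul_sum, Finset.sum_mul]
          rw [Finset.sum_comm]
          exact Finset.sum_congr rfl fun i _ => Finset.sum_congr rfl fun j _ => by ring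
  have h2 : ∑ j ∈ B, ω j * ∑ i, ξ i j * sqNorm (c - s i)
      ≤ ∑ j ∈ B, ((1 + δ) * (ω j * ∑ i, ξ i j * sqNorm (p j - s i))
        + (1 + 1 / δ) * (ω j * sqNorm (p j - c))) := by
    refine Finset.sum_le_sum fun j hj => ?_
    have h3 : ∑ i, ξ i j * sqNorm (c - s i) ≤ ∑ i, (ξ i j * ((1 + δ) * sqNorm (p j - s i))
        + ξ i j * ((1 + 1 / δ) * sqNorm (p j - c))) := by
      refine Finset.sum_le_sum fun i _ => ?_
      rw [← mul_add, sqNorm_sub_comm (p j) c]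
      exact mul_le_mul_of_nonneg_left (sqNorm_sub_le hδ _ _ _) (hξ i j)
    rw [Finset.sum_add_distrib, ← Finset.sum_mul, hξ1 j hj, one_mul] at h3
    calc _ ≤ ω j * _ := mul_le_mul_of_nonneg_left h3 (hω j).le
      _ = _ := by
        have : ∑ i, ξ i j * ((1 + δ) * sqNorm (p j - s i))
            = (1 + δ) * ∑ i, ξ i j * sqNorm (p j - s i) := by
          rw [Finset.mul_sum]
          exact Finset.sum_congr rfl fun i _ => by ring
        rw [this]
        ring
  rw [Finset.sum_add_distrib, ← Finset.mul_sum, ← Finset.mul_sum] at h2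
  have h4 : scatter ω p B = ∑ j ∈ B, ω j * sqNorm (p j - c) := rfl
  rw [← h4] at h2
  rw [h1]
  linarith

end Batch

/-- If every admissible clustering can be made constant on the fibres of `g` at a relative loss
of at most `ε`, then the centroids of the fibres form an `ε`-coreset. -/
lemma exists_coreset_of_partition {d k n : ℕ} {β : Type*} [DecidableEq β] (x : Fin n → Fin d → ℝ)
    {ω : Fin n → ℝ} (hω : ∀ j, 0 < ω j) (κlo κhi : Fin k → ℝ)
    (hne : ∃ ξ, IsWCC κlo κhi ω ξ) {ε : ℝ} (hε : 0 < ε) (g : Fin n → β)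
    (hg : ∀ (s : Fin k → Fin d → ℝ) (ξ : Fin k → Fin n → ℝ), IsWCC κlo κhi ω ξ →
      ∃ η : Fin k → Fin n → ℝ, IsWCC κlo κhi ω η ∧ (∀ i j j', g j = g j' → η i j = η i j') ∧
        cost (fun _ : Fin k => (1 : Matrix (Fin d) (Fin d) ℝ)) x ω η s
          ≤ (1 + ε) * cost (fun _ : Fin k => (1 : Matrix (Fin d) (Fin d) ℝ)) x ω ξ s) :
    ∃ (x' : Fin (univ.image g).card → Fin d → ℝ) (ω' : Fin (univ.image g).card → ℝ),
      (∀ j', 0 < ω' j') ∧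
      ∃ f Δp Δm, IsCoresetWith ε 1 κlo κhi
        (fun _ : Fin k => (1 : Matrix (Fin d) (Fin d) ℝ)) x ω x' ω' f Δp Δm := by
  set m := (univ.image g).card
  let e : Fin m ≃ (univ.image g) := (univ.image g).equivFin.symm
  let G : Fin n → Fin m := fun j => e.symm ⟨g j, mem_image_of_mem g (mem_univ j)⟩
  have hGg : ∀ j j', G j = G j' ↔ g j = g j' := fun j j' => by simp [G]
  have hGs : Function.Surjective G := fun b => by
    obtain ⟨j, -, hj⟩ := mem_image.1 (e b).2
    refine ⟨j, ?_⟩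
    simp [G, hj]
  obtain ⟨rep, hrep⟩ := hGs.hasRightInverse
  let B : Fin m → Finset (Fin n) := fun b => univ.filter fun j => G j = b
  have hB : ∀ F : Fin n → ℝ, ∑ j, F j = ∑ b, ∑ j ∈ B b, F j := fun F =>
    (Finset.sum_fiberwise univ G F).symm
  let ω' : Fin m → ℝ := fun b => ∑ j ∈ B b, ω j
  let x' : Fin m → Fin d → ℝ := fun b => centroidOn ω x (B b)
  let f : (Fin k → Fin m → ℝ) → (Fin k → Fin n → ℝ) := fun ξ' i j => ξ' i (G j)
  let V : ℝ := ∑ b, scatter ω x (B b)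
  have hV : 0 ≤ V := Finset.sum_nonneg fun b _ => scatter_nonneg hω x _
  have hω' : ∀ b, 0 < ω' b := fun b =>
    Finset.sum_pos (fun j _ => hω j) ⟨rep b, by simp [B, hrep b]⟩
  have hweight : ∀ ξ' : Fin k → Fin m → ℝ, ∀ i,
      clusterWeight ω (f ξ') i = clusterWeight ω' ξ' i := fun ξ' i => by
    unfold clusterWeight
    rw [hB]
    refine Finset.sum_congr rfl fun b _ => ?_
    rw [Finset.mul_sum]
    refine Finset.sum_congr rfl fun j hj => ?_
    rw [← (mem_filter.1 hj).2]
  have hcost : ∀ (ξ' : Fin k → Fin m → ℝ) (s : Fin k → Fin d → ℝ), IsClustering ξ' →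
      cost (fun _ : Fin k => (1 : Matrix (Fin d) (Fin d) ℝ)) x ω (f ξ') s
        = cost (fun _ : Fin k => (1 : Matrix (Fin d) (Fin d) ℝ)) x' ω' ξ' s + V :=
    fun ξ' s hξ' => by
    rw [cost_one_eq, cost_one_eq, hB, ← Finset.sum_add_distrib]
    refine Finset.sum_congr rfl fun b _ => ?_
    calc ∑ j ∈ B b, ω j * ∑ i, f ξ' i j * sqNorm (x j - s i)
        = ∑ j ∈ B b, ω j * ∑ i, ξ' i b * sqNorm (x j - s i) := by
          refine Finset.sum_congr rfl fun j hj => ?_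
          rw [← (mem_filter.1 hj).2]
      _ = ∑ i, ξ' i b * ∑ j ∈ B b, ω j * sqNorm (x j - s i) := by
          simp only [Finset.mul_sum]
          rw [Finset.sum_comm]
          exact Finset.sum_congr rfl fun i _ => Finset.sum_congr rfl fun j _ => by ring
      _ = ∑ i, (ω' b * (ξ' i b * sqNorm (x' b - s i)) + ξ' i b * scatter ω x (B b)) := by
          refine Finset.sum_congr rfl fun i _ => ?_
          rw [sum_sqNorm_sub_eq hω]
          ring
      _ = _ := by
          rw [Finset.sum_add_distrib, ← Finset.sum_mul, hξ'.2 b, one_mul, Finset.mul_sum]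
  refine ⟨x', ω', hω', f, V, V, hV, (one_mul V).ge, ?_, ?_⟩
  · intro ξ' h
    refine ⟨⟨fun i j => h.1.1 i _, fun j => h.1.2 _⟩, fun i => ?_⟩
    rw [hweight]
    exact h.2 i
  intro s ξ' h
  constructor
  · rw [hcost ξ' s h.1]
    have h1 := cost_one_nonneg x' hω' h.1 s
    nlinarith [mul_nonneg hε.le h1, mul_nonneg hε.le hV]
  have hε1 : 0 < 1 + ε := by linarith
  rw [← div_le_iff₀' hε1]
  obtain ⟨ξ0, hξ0⟩ := hne
  refine le_csInf ⟨_, ξ0, hξ0, rfl⟩ ?_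
  rintro _ ⟨ξ, hξ, rfl⟩
  rw [div_le_iff₀' hε1]
  obtain ⟨η, hη, hηg, hle⟩ := hg s ξ hξ
  refine le_trans ?_ hle
  let ζ : Fin k → Fin m → ℝ := fun i b => η i (rep b)
  have hfζ : f ζ = η := by
    funext i j
    exact hηg i _ _ ((hGg _ _).1 (hrep (G j)))
  have hζ : IsWCC κlo κhi ω' ζ := by
    refine ⟨⟨fun i b => hη.1.1 i _, fun b => hη.1.2 _⟩, fun i => ?_⟩
    rw [← hweight, hfζ]
    exact hη.2 i
  have := hcost ζ s hζ.1
  rw [hfζ] at this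
  rw [this]
  have hbdd : BddBelow {c : ℝ | ∃ ξ, IsWCC κlo κhi ω' ξ ∧
      c = cost (fun _ : Fin k => (1 : Matrix (Fin d) (Fin d) ℝ)) x' ω' ξ s} := by
    refine ⟨0, ?_⟩
    rintro _ ⟨ξ1, hξ1, rfl⟩
    exact cost_one_nonneg x' hω' hξ1.1 s
  exact add_le_add (csInf_le hbdd ⟨ζ, hζ, rfl⟩) le_rfl

/-- Averaging an assignment over the fibres of `g` preserves weights, and the cost only increases
on the fibres on which the assignment is not constant. -/
lemma exists_average {d k n : ℕ} {β : Type*} [DecidableEq β] (p : Fin n → Fin d → ℝ)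
    {ω : Fin n → ℝ} (hω : ∀ j, 0 < ω j) (g : Fin n → β) (bad : Finset β)
    {ξ : Fin k → Fin n → ℝ} (hξ : IsClustering ξ)
    (hconst : ∀ j j', g j = g j' → g j ∉ bad → ∀ i, ξ i j = ξ i j')
    (s : Fin k → Fin d → ℝ) {δ : ℝ} (hδ : 0 < δ) :
    ∃ η : Fin k → Fin n → ℝ, IsClustering η ∧ (∀ i, clusterWeight ω η i = clusterWeight ω ξ i) ∧
      (∀ i j j', g j = g j' → η i j = η i j') ∧
      cost (fun _ : Fin k => (1 : Matrix (Fin d) (Fin d) ℝ)) p ω η s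
        ≤ (1 + δ) * cost (fun _ : Fin k => (1 : Matrix (Fin d) (Fin d) ℝ)) p ω ξ s
          + (2 + 1 / δ) * ∑ b ∈ bad, scatter ω p (univ.filter fun j => g j = b) := by
  let B : β → Finset (Fin n) := fun b => univ.filter fun j => g j = b
  let I := univ.image g
  have hB : ∀ F : Fin n → ℝ, ∑ j, F j = ∑ b ∈ I, ∑ j ∈ B b, F j := fun F =>
    (Finset.sum_fiberwise_of_maps_to (fun j _ => mem_image_of_mem g (mem_univ j)) F).symm
  have hW : ∀ b ∈ I, 0 < ∑ j ∈ B b, ω j := fun b hb => by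
    obtain ⟨j, -, hj⟩ := mem_image.1 hb
    exact Finset.sum_pos (fun j _ => hω j) ⟨j, by simp [B, hj]⟩
  let η : Fin k → Fin n → ℝ := fun i j =>
    (∑ j' ∈ B (g j), ξ i j' * ω j') / ∑ j' ∈ B (g j), ω j'
  have hη : ∀ b ∈ I, ∀ j ∈ B b, ∀ i, η i j = (∑ j' ∈ B b, ξ i j' * ω j') / ∑ j' ∈ B b, ω j' :=
    fun b _ j hj i => by
      have : g j = b := (mem_filter.1 hj).2
      simp only [η, this]
  refine ⟨η, ⟨fun i j => ?_, fun j => ?_⟩, fun i => ?_, fun i j j' h => ?_, ?_⟩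
  · exact div_nonneg (Finset.sum_nonneg fun j' _ => mul_nonneg (hξ.1 _ _) (hω _).le)
      (Finset.sum_nonneg fun j' _ => (hω _).le)
  · simp only [η]
    rw [← Finset.sum_div, Finset.sum_comm,
      div_eq_one_iff_eq (hW _ (mem_image_of_mem g (mem_univ j))).ne']
    refine Finset.sum_congr rfl fun j' _ => ?_
    rw [← Finset.sum_mul, hξ.2, one_mul]
  · unfold clusterWeight
    rw [hB, hB]
    refine Finset.sum_congr rfl fun b hb => ?_
    rw [Finset.sum_congr rfl fun j hj => by rw [hη b hb j hj i], ← Finset.mul_sum,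
      div_mul_cancel₀ _ (hW b hb).ne']
  · simp only [η, h]
  · have hδ2 : 0 ≤ 2 + 1 / δ := by positivity
    have hle : ∀ b ∈ I, ∑ j ∈ B b, ω j * ∑ i, η i j * sqNorm (p j - s i)
        ≤ (1 + δ) * ∑ j ∈ B b, ω j * ∑ i, ξ i j * sqNorm (p j - s i)
          + if b ∈ bad then (2 + 1 / δ) * scatter ω p (B b) else 0 := by
      intro b hb
      by_cases hbad : b ∈ bad
      · rw [if_pos hbad]
        refine le_trans (le_of_eq ?_)
          (batch_average_cost_le hω p (B b) hξ.1 (fun j _ => hξ.2 j) s hδ)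
        exact Finset.sum_congr rfl fun j hj => by simp only [hη b hb j hj]
      · rw [if_neg hbad, add_zero]
        have heq : ∀ j ∈ B b, ∀ i, η i j = ξ i j := fun j hj i => by
          rw [hη b hb j hj, div_eq_iff (hW b hb).ne', Finset.mul_sum]
          refine Finset.sum_congr rfl fun j' hj' => ?_
          have e1 : g j = b := (mem_filter.1 hj).2
          have e2 : g j' = b := (mem_filter.1 hj').2
          rw [hconst j' j (e2.trans e1.symm) (e2 ▸ hbad) i]
        have h0 : 0 ≤ ∑ j ∈ B b, ω j * ∑ i, ξ i j * sqNorm (p j - s i) :=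
          Finset.sum_nonneg fun j _ => mul_nonneg (hω j).le <| Finset.sum_nonneg fun i _ =>
            mul_nonneg (hξ.1 i j) (sqNorm_nonneg _)
        have h1 : ∑ j ∈ B b, ω j * ∑ i, η i j * sqNorm (p j - s i)
            = ∑ j ∈ B b, ω j * ∑ i, ξ i j * sqNorm (p j - s i) :=
          Finset.sum_congr rfl fun j hj => by simp only [heq j hj]
        rw [h1]
        nlinarith
    rw [cost_one_eq, cost_one_eq, hB, hB fun j => ω j * ∑ i, ξ i j * sqNorm (p j - s i)]
    refine (Finset.sum_le_sum hle).trans ?_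
    rw [Finset.sum_add_distrib, ← Finset.mul_sum]
    refine add_le_add le_rfl ?_
    rw [← Finset.sum_filter, Finset.mul_sum]
    exact Finset.sum_le_sum_of_subset_of_nonneg (fun b hb => (mem_filter.1 hb).2)
      fun b _ _ => mul_nonneg hδ2 (scatter_nonneg hω p _)

/-- Greedy batching along a linear order: if `V` is dominated by the additive function `h`, an
index set can be cut into `b + 1` consecutive batches with `V ≤ T` on each, where `T * b` is at
most twice the total of `h`. -/
lemma exists_greedy_batches {ι : Type*} [DecidableEq ι] (r : ι → ℕ) (hr : Function.Injective r)
    (V : Finset ι → ℝ) (h : ι → ℝ) (hV0 : V ∅ = 0) (hV1 : ∀ a, V {a} = 0)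
    (hVh : ∀ B, V B ≤ ∑ j ∈ B, h j) {T : ℝ} (hT : 0 ≤ T) (J : Finset ι) :
    ∃ (g : ι → ℕ) (b : ℕ), (∀ j ∈ J, g j ≤ b) ∧ (∀ j ∈ J, ∀ j' ∈ J, r j ≤ r j' → g j ≤ g j') ∧
      (∀ c, V (J.filter fun j => g j = c) ≤ T) ∧
      T * b ≤ 2 * ∑ j ∈ J.filter (fun j => g j ≠ b), h j := by
  induction J using Finset.induction_on_max_value r with
  | empty => exact ⟨fun _ => 0, 0, by simp, by simp, by simpa [hV0] using hT, by simp⟩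
  | insert a J haJ hmax ih =>
    obtain ⟨g, b, hgb, hmono, hVT, hTb⟩ := ih
    have hne : ∀ j ∈ J, j ≠ a := fun j hj e => haJ (e ▸ hj)
    have hlt : ∀ j ∈ J, ¬ r a ≤ r j := fun j hj h1 =>
      hne j hj (hr (le_antisymm (hmax j hj) h1))
    have hfilter : ∀ (v : ℕ) (P : ℕ → Prop) [DecidablePred P],
        J.filter (fun j => P (Function.update g a v j)) = J.filter fun j => P (g j) :=
      fun v P _ => Finset.filter_congr fun j hj => by rw [Function.update_of_ne (hne j hj)]
    have hmono' : ∀ v, b ≤ v → ∀ j ∈ insert a J, ∀ j' ∈ insert a J, r j ≤ r j' →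
        Function.update g a v j ≤ Function.update g a v j' := by
      intro v hv j hj j' hj' hjj'
      rcases mem_insert.1 hj with rfl | h1 <;> rcases mem_insert.1 hj' with rfl | h2
      · exact le_rfl
      · exact absurd hjj' (hlt j' h2)
      · rw [Function.update_self, Function.update_of_ne (hne j h1)]
        exact (hgb j h1).trans hv
      · rw [Function.update_of_ne (hne j h1), Function.update_of_ne (hne j' h2)]
        exact hmono j h1 j' h2 hjj'
    by_cases hcase : V (insert a (J.filter fun j => g j = b)) ≤ T
    · refine ⟨Function.update g a b, b, ?_, hmono' b le_rfl, fun c => ?_, ?_⟩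
      · intro j hj
        rcases mem_insert.1 hj with rfl | hj
        · simp
        · rw [Function.update_of_ne (hne j hj)]
          exact hgb j hj
      · rw [Finset.filter_insert, hfilter b (fun v => v = c), Function.update_self]
        split_ifs with hc
        · subst hc
          exact hcase
        · exact hVT c
      · rw [Finset.filter_insert, hfilter b (fun v => v ≠ b), Function.update_self, if_neg (by simp)]
        exact hTb
    · refine ⟨Function.update g a (b + 1), b + 2, ?_, hmono' _ (by omega), fun c => ?_, ?_⟩
      · intro j hj
        rcases mem_insert.1 hj with rfl | hj
        · simp
        · rw [Function.update_of_ne (hne j hj)]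
          exact (hgb j hj).trans (by omega)
      · rw [Finset.filter_insert, hfilter _ (fun v => v = c), Function.update_self]
        split_ifs with hc
        · subst hc
          have : J.filter (fun j => g j = b + 1) = ∅ :=
            Finset.filter_eq_empty_iff.2 fun j hj => by have := hgb j hj; omega
          rw [this]
          simpa [hV1] using hT
        · exact hVT c
      · have h1 : (insert a J).filter (fun j => Function.update g a (b + 1) j ≠ b + 2)
            = insert a J := by
          refine Finset.filter_true_of_mem fun j hj => ?_
          rcases mem_insert.1 hj with rfl | hj
          · simp
          · rw [Function.update_of_ne (hne j hj)]
            have := hgb j hj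
            omega
        rw [h1, Finset.sum_insert haJ, ← Finset.sum_filter_add_sum_filter_not J (fun j => g j = b)]
        have h2 := hVh (insert a (J.filter fun j => g j = b))
        rw [Finset.sum_insert (by simp [haJ])] at h2
        have h3 : T * (b : ℝ) ≤ 2 * ∑ j ∈ J.filter (fun j => ¬ g j = b), h j := hTb
        push_cast
        push Not at hcase
        linarith

/-- Abel summation: partial sums that are nonpositive and end at zero pair nonnegatively with a
nondecreasing sequence. -/
lemma sum_mul_nonneg_of_partial_sums {k : ℕ} {a e : ℕ → ℝ}
    (ha : ∀ m, m + 1 < k → a m ≤ a (m + 1)) (he : ∀ m ≤ k, ∑ i ∈ range m, e i ≤ 0)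
    (hk : ∑ i ∈ range k, e i = 0) : 0 ≤ ∑ i ∈ range k, a i * e i := by
  rcases k with _ | k
  · simp
  have key : ∀ m ≤ k, a m * ∑ i ∈ range (m + 1), e i ≤ ∑ i ∈ range (m + 1), a i * e i := by
    intro m
    induction m with
    | zero => simp
    | succ m ih =>
      intro hm
      rw [Finset.sum_range_succ, Finset.sum_range_succ _ (m + 1)]
      have h1 := ih (by omega)
      have h2 := ha m (by omega)
      have h3 := he (m + 1) (by omega)
      nlinarith
  have := key k le_rfl
  rwa [hk, mul_zero] at this

section Transport

variable {ι : Type*} (J : Finset ι) (r : ι → ℕ) (ω : ι → ℝ)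

/-- Total weight of the elements of `J` of rank less than `N`. -/
def massBelow (N : ℕ) : ℝ := ∑ j ∈ J.filter (fun j => r j < N), ω j

/-- The part of element `j` that is used when the first `w` units of mass are taken in order of
increasing rank. -/
def greedyPart (w : ℝ) (j : ι) : ℝ :=
  min (massBelow J r ω (r j + 1)) w - min (massBelow J r ω (r j)) w

variable {J r ω}

lemma massBelow_mono (hω : ∀ j, 0 ≤ ω j) : Monotone (massBelow J r ω) := fun _ _ h =>
  Finset.sum_le_sum_of_subset_of_nonneg
    (fun _ hj => mem_filter.2 ⟨(mem_filter.1 hj).1, (mem_filter.1 hj).2.trans_le h⟩)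
    fun j _ _ => hω j

lemma massBelow_nonneg (hω : ∀ j, 0 ≤ ω j) (N : ℕ) : 0 ≤ massBelow J r ω N :=
  Finset.sum_nonneg fun j _ => hω j

lemma massBelow_le (hω : ∀ j, 0 ≤ ω j) (N : ℕ) : massBelow J r ω N ≤ ∑ j ∈ J, ω j :=
  Finset.sum_le_sum_of_subset_of_nonneg (filter_subset _ _) fun j _ _ => hω j

lemma massBelow_succ (hr : Function.Injective r) {j : ι} (hj : j ∈ J) :
    massBelow J r ω (r j + 1) = massBelow J r ω (r j) + ω j := by
  classical
  unfold massBelow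
  have : J.filter (fun j' => r j' < r j + 1) = insert j (J.filter fun j' => r j' < r j) := by
    ext j'
    simp only [mem_filter, mem_insert]
    constructor
    · rintro ⟨h1, h2⟩
      rcases (Nat.lt_succ_iff.1 h2).eq_or_lt with h | h
      · exact Or.inl (hr h)
      · exact Or.inr ⟨h1, h⟩
    · rintro (rfl | ⟨h1, h2⟩)
      · exact ⟨hj, Nat.lt_succ_self _⟩
      · exact ⟨h1, h2.trans (Nat.lt_succ_self _)⟩
  rw [this, Finset.sum_insert (by simp), add_comm]

lemma greedyPart_of_le (hr : Function.Injective r) (hω : ∀ j, 0 ≤ ω j) {w : ℝ} {j : ι}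
    (hj : j ∈ J) (h : massBelow J r ω (r j + 1) ≤ w) : greedyPart J r ω w j = ω j := by
  have := massBelow_mono (J := J) (r := r) hω (Nat.le_succ (r j))
  unfold greedyPart
  rw [min_eq_left h, min_eq_left (this.trans h), massBelow_succ hr hj]
  ring

lemma greedyPart_of_ge (hω : ∀ j, 0 ≤ ω j) {w : ℝ} {j : ι}
    (h : w ≤ massBelow J r ω (r j)) : greedyPart J r ω w j = 0 := by
  have := massBelow_mono (J := J) (r := r) hω (Nat.le_succ (r j))
  unfold greedyPart
  rw [min_eq_right h, min_eq_right (h.trans this)]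
  ring

lemma greedyPart_mono (hω : ∀ j, 0 ≤ ω j) (j : ι) : Monotone fun w => greedyPart J r ω w j := by
  intro w w' h
  have := massBelow_mono (J := J) (r := r) hω (Nat.le_succ (r j))
  simp only [greedyPart, Nat.succ_eq_add_one] at *
  simp only [min_def]
  split_ifs <;> linarith

lemma sum_greedyPart (hr : Function.Injective r) {w : ℝ} (hw : 0 ≤ w)
    (hw' : w ≤ ∑ j ∈ J, ω j) : ∑ j ∈ J, greedyPart J r ω w j = w := by
  classical
  obtain ⟨R, hR⟩ : ∃ R, ∀ j ∈ J, r j < R :=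
    ⟨J.sup r + 1, fun j hj => Nat.lt_succ_of_le (Finset.le_sup (f := r) hj)⟩
  let F : ℕ → ℝ := fun N => min (massBelow J r ω N) w
  have h1 : ∑ j ∈ J, greedyPart J r ω w j = ∑ N ∈ J.image r, (F (N + 1) - F N) := by
    rw [Finset.sum_image fun _ _ _ _ h => hr h]
    rfl
  have h2 : ∑ N ∈ J.image r, (F (N + 1) - F N) = ∑ N ∈ range R, (F (N + 1) - F N) := by
    refine Finset.sum_subset (fun N hN => ?_) fun N _ hN => ?_
    · obtain ⟨j, hj, rfl⟩ := mem_image.1 hN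
      exact mem_range.2 (hR j hj)
    · have : massBelow J r ω (N + 1) = massBelow J r ω N := by
        unfold massBelow
        congr 1
        refine Finset.filter_congr fun j hj => ?_
        have : r j ≠ N := fun h => hN (mem_image.2 ⟨j, hj, h⟩)
        omega
      simp only [F, this, sub_self]
  have h3 : massBelow J r ω R = ∑ j ∈ J, ω j := by
    unfold massBelow
    rw [Finset.filter_true_of_mem hR]
  have h4 : massBelow J r ω 0 = 0 := by simp [massBelow]
  rw [h1, h2, Finset.sum_range_sub]
  simp only [F, h3, h4]
  rw [min_eq_right hw', min_eq_left hw, sub_zero]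

/-- Among all ways of taking `w` units of mass, taking them in order minimises the first moment. -/
lemma sum_greedyPart_mul_le (hr : Function.Injective r) (hω : ∀ j, 0 ≤ ω j) {t : ι → ℝ}
    (ht : ∀ j ∈ J, ∀ j' ∈ J, r j ≤ r j' → t j ≤ t j') {α : ι → ℝ} (hα : ∀ j ∈ J, 0 ≤ α j)
    (hα' : ∀ j ∈ J, α j ≤ ω j) :
    ∑ j ∈ J, greedyPart J r ω (∑ j ∈ J, α j) j * t j ≤ ∑ j ∈ J, α j * t j := by
  set w := ∑ j ∈ J, α j with hw
  have hw0 : 0 ≤ w := Finset.sum_nonneg hα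
  have hw1 : w ≤ ∑ j ∈ J, ω j := Finset.sum_le_sum hα'
  rcases J.eq_empty_or_nonempty with hJ | hJ
  · subst hJ
    simp
  obtain ⟨jm, hjm, hmax⟩ := J.exists_max_image r hJ
  have hne : (J.filter fun j => w ≤ massBelow J r ω (r j + 1)).Nonempty := by
    refine ⟨jm, mem_filter.2 ⟨hjm, hw1.trans (le_of_eq ?_)⟩⟩
    unfold massBelow
    rw [Finset.filter_true_of_mem fun j hj => Nat.lt_succ_of_le (hmax j hj)]
  obtain ⟨j0, hj0, hmin⟩ := Finset.exists_min_image _ r hne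
  obtain ⟨hj0J, hj0w⟩ := mem_filter.1 hj0
  have key : ∀ j ∈ J, 0 ≤ (α j - greedyPart J r ω w j) * (t j - t j0) := by
    intro j hj
    rcases lt_trichotomy (r j) (r j0) with h | h | h
    · have h1 : massBelow J r ω (r j + 1) ≤ w := by
        by_contra! hc
        exact absurd (hmin j (mem_filter.2 ⟨hj, hc.le⟩)) (not_le.2 h)
      rw [greedyPart_of_le hr hω hj h1]
      exact mul_nonneg_of_nonpos_of_nonpos (by linarith [hα' j hj])
        (by linarith [ht j hj j0 hj0J h.le])
    · rw [hr h]
      simp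
    · have h1 : w ≤ massBelow J r ω (r j) := hj0w.trans (massBelow_mono hω h)
      rw [greedyPart_of_ge hω h1]
      exact mul_nonneg (by linarith [hα j hj]) (by linarith [ht j0 hj0J j hj h.le])
  have h1 := Finset.sum_nonneg key
  have h2 : ∑ j ∈ J, (α j - greedyPart J r ω w j) * (t j - t j0)
      = ∑ j ∈ J, α j * t j - ∑ j ∈ J, greedyPart J r ω w j * t j
        - (∑ j ∈ J, α j - ∑ j ∈ J, greedyPart J r ω w j) * t j0 := by
    simp only [sub_mul, mul_sub, Finset.sum_sub_distrib, Finset.sum_mul]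
  rw [h2, sum_greedyPart hr hw0 hw1, ← hw] at h1
  linarith

/-- The number of consecutive batches of which greedy filling at the levels `W 0 ≤ W 1 ≤ …` puts
mass into more than one slot is bounded by the number of levels. -/
lemma card_split_batches_le [DecidableEq ι] (hr : Function.Injective r) (hω : ∀ j, 0 ≤ ω j)
    {k : ℕ} {W : ℕ → ℝ} (hW : ∀ m < k, W m ≤ W (m + 1)) (hW0 : W 0 = 0)
    (hWk : W k = ∑ j ∈ J, ω j) {g : ι → ℕ}
    (hg : ∀ j ∈ J, ∀ j' ∈ J, r j ≤ r j' → g j ≤ g j') (bad : Finset ℕ)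
    (hbad : ∀ b ∈ bad, (∃ j ∈ J, g j = b ∧ 0 < ω j) ∧
      ¬ ∃ m < k, ∀ j ∈ J, g j = b → ∀ m' < k, m' ≠ m →
        greedyPart J r ω (W (m' + 1)) j - greedyPart J r ω (W m') j = 0) :
    bad.card ≤ k + 1 := by
  let lo : ℕ → ℝ := fun b => ∑ j ∈ J.filter (fun j => g j < b), ω j
  have hlo_mono : Monotone lo := fun b b' h => Finset.sum_le_sum_of_subset_of_nonneg
    (fun j hj => mem_filter.2 ⟨(mem_filter.1 hj).1, (mem_filter.1 hj).2.trans_le h⟩)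
    fun j _ _ => hω j
  have hWmono : ∀ m' m, m ≤ m' → m' ≤ k → W m ≤ W m' := by
    intro m' m h
    induction m', h using Nat.le_induction with
    | base => exact fun _ => le_rfl
    | succ m' _ ih => exact fun hk => (ih (by omega)).trans (hW m' (by omega))
  have hex : ∀ b ∈ bad, ∃ m ∈ range (k + 1), lo b < W m ∧ W m < lo (b + 1) := by
    intro b hb
    obtain ⟨⟨j0, hj0, hj0b, hj0ω⟩, hsplit⟩ := hbad b hb
    by_contra! hno
    have hlohi : lo b < lo (b + 1) := by
      have : insert j0 (J.filter fun j => g j < b) ⊆ J.filter fun j => g j < b + 1 := by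
        intro j hj
        rcases mem_insert.1 hj with rfl | hj
        · exact mem_filter.2 ⟨hj0, by omega⟩
        · exact mem_filter.2 ⟨(mem_filter.1 hj).1, by have := (mem_filter.1 hj).2; omega⟩
      have h2 := Finset.sum_le_sum_of_subset_of_nonneg (f := ω) this fun j _ _ => hω j
      rw [Finset.sum_insert (by simp [hj0b])] at h2
      simp only [lo]
      linarith
    have hlo0 : 0 ≤ lo b := Finset.sum_nonneg fun j _ => hω j
    have hP : ∃ m, lo (b + 1) ≤ W m ∧ m ≤ k := ⟨k, hWk ▸
      Finset.sum_le_sum_of_subset_of_nonneg (filter_subset _ _) fun j _ _ => hω j, le_rfl⟩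
    classical
    obtain ⟨hm1, hmk⟩ := Nat.find_spec hP
    have hmin : ∀ m < Nat.find hP, W m ≤ lo b := fun m hm => by
      by_contra! hc
      exact Nat.find_min hP hm ⟨hno m (mem_range.2 (by omega)) hc, by omega⟩
    set m := Nat.find hP
    have hm0 : m ≠ 0 := fun h => by
      rw [h, hW0] at hm1
      linarith
    refine hsplit ⟨m - 1, by omega, fun j hj hjb m' hm' hne => ?_⟩
    have hjlo : lo b ≤ massBelow J r ω (r j) := by
      refine Finset.sum_le_sum_of_subset_of_nonneg (fun j' hj' => ?_) fun j _ _ => hω j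
      obtain ⟨h1, h2⟩ := mem_filter.1 hj'
      refine mem_filter.2 ⟨h1, ?_⟩
      by_contra! hc
      have := hg j hj j' h1 hc
      omega
    have hjhi : massBelow J r ω (r j + 1) ≤ lo (b + 1) := by
      refine Finset.sum_le_sum_of_subset_of_nonneg (fun j' hj' => ?_) fun j _ _ => hω j
      obtain ⟨h1, h2⟩ := mem_filter.1 hj'
      refine mem_filter.2 ⟨h1, ?_⟩
      have := hg j' h1 j hj (Nat.lt_succ_iff.1 h2)
      omega
    have hsmall : ∀ m' < m, greedyPart J r ω (W m') j = 0 := fun m' h =>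
      greedyPart_of_ge hω ((hmin m' h).trans hjlo)
    have hlarge : ∀ m' ≤ k, m ≤ m' → greedyPart J r ω (W m') j = ω j := fun m' h h' =>
      greedyPart_of_le hr hω hj (hjhi.trans (hm1.trans (hWmono _ _ h' h)))
    rcases lt_or_ge m' (m - 1) with h | h
    · rw [hsmall _ (by omega), hsmall _ (by omega), sub_zero]
    · rw [hlarge _ (by omega) (by omega), hlarge _ (by omega) (by omega), sub_self]
  choose! φ hφ hφ1 hφ2 using hex
  have := Finset.card_le_card_of_injOn φ (fun b hb => hφ b hb) (fun b hb b' hb' h => by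
    by_contra hne
    have aux : ∀ b ∈ bad, ∀ b' ∈ bad, φ b = φ b' → ¬ b < b' := fun b hb b' hb' h hlt => by
      have h1 := hφ2 b hb
      have h2 := hφ1 b' hb'
      have h3 : lo (b + 1) ≤ lo b' := hlo_mono hlt
      rw [h] at h1
      linarith
    rcases lt_or_gt_of_ne hne with h1 | h1
    · exact aux b hb b' hb' h h1
    · exact aux b' hb' b hb h.symm h1)
  simpa using this

end Transport

/-- A transport plan between linearly ordered points and slots with slopes `a` can be replaced by a
monotone one: it has the same marginals, pairs `t` and `a` at least as well, and splits at most
`k + 1` of any family of consecutive batches. -/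
lemma exists_monotone_rearrangement {ι : Type*} [DecidableEq ι] {k : ℕ} {J : Finset ι}
    {r : ι → ℕ} (hr : Function.Injective r) {ω : ι → ℝ} (hω : ∀ j, 0 < ω j) {t : ι → ℝ}
    (ht : ∀ j ∈ J, ∀ j' ∈ J, r j ≤ r j' → t j ≤ t j') (a : Fin k → ℝ) {π : Fin k → ι → ℝ}
    (hπ : ∀ i j, 0 ≤ π i j) (hπω : ∀ j, ∑ i, π i j = ω j) :
    ∃ ρ : Fin k → ι → ℝ, (∀ i j, 0 ≤ ρ i j) ∧ (∀ j ∈ J, ∑ i, ρ i j = ω j) ∧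
      (∀ i, ∑ j ∈ J, ρ i j = ∑ j ∈ J, π i j) ∧
      ∑ i, a i * ∑ j ∈ J, π i j * t j ≤ ∑ i, a i * ∑ j ∈ J, ρ i j * t j ∧
      ∀ g : ι → ℕ, (∀ j ∈ J, ∀ j' ∈ J, r j ≤ r j' → g j ≤ g j') → ∀ bad : Finset ℕ,
        (∀ b ∈ bad, (∃ j ∈ J, g j = b) ∧
          ¬ ∃ i, ∀ j ∈ J, g j = b → ∀ i', i' ≠ i → ρ i' j = 0) → bad.card ≤ k + 1 := by
  let σ := Tuple.sort a
  have hσ : Monotone (a ∘ σ) := Tuple.monotone_sort a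
  have hω0 : ∀ j, 0 ≤ ω j := fun j => (hω j).le
  let P : ℕ → ι → ℝ := fun m j => if h : m < k then π (σ ⟨m, h⟩) j else 0
  let a' : ℕ → ℝ := fun m => if h : m < k then a (σ ⟨m, h⟩) else 0
  have hPi : ∀ (i : Fin k) j, P (σ.symm i) j = π i j := fun i j => by
    simp [P, (σ.symm i).isLt]
  have hai : ∀ i : Fin k, a' (σ.symm i) = a i := fun i => by
    simp [a', (σ.symm i).isLt]
  have hsum : ∀ F : ℕ → ℝ, ∑ i : Fin k, F (σ.symm i) = ∑ m ∈ range k, F m := fun F => by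
    rw [Equiv.sum_comp σ.symm fun i : Fin k => F i, Fin.sum_univ_eq_sum_range]
  have hP : ∀ m j, 0 ≤ P m j := fun m j => by
    simp only [P]
    split_ifs
    · exact hπ _ _
    · exact le_rfl
  let α : ℕ → ι → ℝ := fun m j => ∑ m' ∈ range m, P m' j
  let W : ℕ → ℝ := fun m => ∑ j ∈ J, α m j
  have hα0 : ∀ m j, 0 ≤ α m j := fun m j => Finset.sum_nonneg fun m' _ => hP m' j
  have hαk : ∀ j, α k j = ω j := fun j => by
    rw [← hπω j]
    simp only [α]
    rw [← hsum fun m => P m j]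
    simp only [hPi]
  have hαsucc : ∀ m j, α (m + 1) j = α m j + P m j := fun m j => Finset.sum_range_succ _ _
  have hαle : ∀ m ≤ k, ∀ j, α m j ≤ ω j := fun m hm j => by
    rw [← hαk j]
    exact Finset.sum_le_sum_of_subset_of_nonneg (range_mono hm) fun m' _ _ => hP m' j
  have hWsucc : ∀ m, W (m + 1) = W m + ∑ j ∈ J, P m j := fun m => by
    simp only [W, hαsucc, Finset.sum_add_distrib]
  have hW : ∀ m, W m ≤ W (m + 1) := fun m => by
    rw [hWsucc]
    linarith [Finset.sum_nonneg fun j (_ : j ∈ J) => hP m j]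
  have hW0 : W 0 = 0 := by simp [W, α]
  have hWk : W k = ∑ j ∈ J, ω j := by simp only [W, hαk]
  have hWnn : ∀ m, 0 ≤ W m := fun m => Finset.sum_nonneg fun j _ => hα0 m j
  have hWle : ∀ m ≤ k, W m ≤ ∑ j ∈ J, ω j := fun m hm => Finset.sum_le_sum fun j _ => hαle m hm j
  let G : ℕ → ι → ℝ := fun m j => greedyPart J r ω (W m) j
  have hG0 : ∀ j, G 0 j = 0 := fun j => greedyPart_of_ge hω0 (hW0 ▸ massBelow_nonneg hω0 _)
  have hGk : ∀ j ∈ J, G k j = ω j := fun j hj =>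
    greedyPart_of_le hr hω0 hj (hWk ▸ massBelow_le hω0 _)
  refine ⟨fun i j => G (σ.symm i + 1) j - G (σ.symm i) j, fun i j => ?_, fun j hj => ?_,
    fun i => ?_, ?_, ?_⟩
  · exact sub_nonneg.2 (greedyPart_mono hω0 j (hW _))
  · rw [hsum fun m => G (m + 1) j - G m j, Finset.sum_range_sub fun m => G m j, hGk j hj, hG0,
      sub_zero]
  · have hi := (σ.symm i).isLt
    simp only [Finset.sum_sub_distrib, G]
    rw [sum_greedyPart hr (hWnn _) (hWle _ (by omega)), sum_greedyPart hr (hWnn _) (hWle _ hi.le),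
      hWsucc]
    simp only [hPi]
    ring
  · let e : ℕ → ℝ := fun m => ∑ j ∈ J, (G (m + 1) j - G m j) * t j - ∑ j ∈ J, P m j * t j
    have hpart : ∀ m, ∑ m' ∈ range m, e m' = ∑ j ∈ J, G m j * t j - ∑ j ∈ J, α m j * t j := by
      intro m
      induction m with
      | zero => simp [hG0, α]
      | succ m ih =>
        rw [Finset.sum_range_succ, ih]
        simp only [e, hαsucc, add_mul, sub_mul, Finset.sum_add_distrib, Finset.sum_sub_distrib]
        ring
    have key := sum_mul_nonneg_of_partial_sums (k := k) (a := a') (e := e) (fun m hm => ?_)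
      (fun m hm => ?_) ?_
    · rw [← hsum fun m => a' m * e m] at key
      simp only [hai, e, hPi, mul_sub, Finset.sum_sub_distrib] at key
      simp only [mul_sub, sub_mul, Finset.sum_sub_distrib] at key ⊢
      linarith
    · have hm' : m < k := by omega
      simp only [a', hm, hm', dif_pos]
      exact hσ (Fin.mk_le_mk.2 (Nat.le_succ m))
    · rw [hpart]
      have := sum_greedyPart_mul_le hr hω0 ht (α := α m) (fun j _ => hα0 m j)
        (fun j _ => hαle m hm j)
      simp only [G, W]
      linarith
    · rw [hpart, sub_eq_zero]
      exact Finset.sum_congr rfl fun j hj => by rw [hGk j hj, hαk]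
  · intro g hg bad hbad
    refine card_split_batches_le hr hω0 (fun m _ => hW m) hW0 hWk hg bad fun b hb => ?_
    obtain ⟨⟨j, hj, hjb⟩, hn⟩ := hbad b hb
    refine ⟨⟨j, hj, hjb, hω j⟩, fun ⟨m, hm, h⟩ => hn ⟨σ ⟨m, hm⟩, fun j hj hjb i' hi' => ?_⟩⟩
    refine h j hj hjb _ (σ.symm i').isLt fun h' => hi' ?_
    rw [← σ.symm_apply_eq]
    exact Fin.ext h'

/-- For points on finitely many lines, every assignment can be replaced by one that is no more
expensive, has the same cluster weights, and is constant on all but few of the given batches of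
consecutive points. -/
lemma exists_assignment_on_lines {d k n : ℕ} {L : Type*} [Fintype L] [DecidableEq L]
    (line : Fin n → L) (z u : L → Fin d → ℝ) (t : Fin n → ℝ) {r : Fin n → ℕ}
    (hr : Function.Injective r) (ht : ∀ j j', r j ≤ r j' → t j ≤ t j') {ω : Fin n → ℝ}
    (hω : ∀ j, 0 < ω j) (g : Fin n → ℕ)
    (hg : ∀ j j', line j = line j' → r j ≤ r j' → g j ≤ g j') (s : Fin k → Fin d → ℝ)
    {ξ : Fin k → Fin n → ℝ} (hξ : IsClustering ξ) :
    ∃ (η : Fin k → Fin n → ℝ) (bad : Finset (Σ _ : L, ℕ)), IsClustering η ∧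
      (∀ i, clusterWeight ω η i = clusterWeight ω ξ i) ∧
      cost (fun _ : Fin k => (1 : Matrix (Fin d) (Fin d) ℝ))
          (fun j => z (line j) + t j • u (line j)) ω η s
        ≤ cost (fun _ : Fin k => (1 : Matrix (Fin d) (Fin d) ℝ))
          (fun j => z (line j) + t j • u (line j)) ω ξ s ∧
      bad.card ≤ Fintype.card L * (k + 1) ∧
      ∀ j j', line j = line j' → g j = g j' → (⟨line j, g j⟩ : Σ _ : L, ℕ) ∉ bad →
        ∀ i, η i j = η i j' := by
  classical
  let J : L → Finset (Fin n) := fun l => univ.filter fun j => line j = l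
  have hJ : ∀ F : Fin n → ℝ, ∑ j, F j = ∑ l, ∑ j ∈ J l, F j := fun F =>
    (Finset.sum_fiberwise univ line F).symm
  have hJm : ∀ j, j ∈ J (line j) := fun j => by simp [J]
  let a : L → Fin k → ℝ := fun l i => ∑ c, u l c * s i c
  have hex := fun l => exists_monotone_rearrangement (J := J l) hr hω
    (fun j _ j' _ => ht j j') (a l) (π := fun i j => ξ i j * ω j)
    (fun i j => mul_nonneg (hξ.1 i j) (hω j).le)
    (fun j => by rw [← Finset.sum_mul, hξ.2, one_mul])
  choose ρ hρ0 hρω hρπ hρle hρbad using hex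
  let η : Fin k → Fin n → ℝ := fun i j => ρ (line j) i j / ω j
  have hηω : ∀ l, ∀ j ∈ J l, ∀ i, η i j * ω j = ρ l i j := fun l j hj i => by
    have : line j = l := (mem_filter.1 hj).2
    simp only [η, this]
    exact div_mul_cancel₀ _ (hω j).ne'
  let bad : L → Finset ℕ := fun l => ((J l).image g).filter fun b =>
    ¬ ∃ i, ∀ j ∈ J l, g j = b → ∀ i', i' ≠ i → ρ l i' j = 0
  have hbad : ∀ l, (bad l).card ≤ k + 1 := fun l => by
    refine hρbad l g (fun j hj j' hj' => hg j j' ?_) (bad l) fun b hb => ?_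
    · rw [(mem_filter.1 hj).2, (mem_filter.1 hj').2]
    · obtain ⟨h1, h2⟩ := mem_filter.1 hb
      exact ⟨mem_image.1 h1, h2⟩
  have hη1 : ∀ j, ∑ i, η i j = 1 := fun j => by
    simp only [η]
    rw [← Finset.sum_div, hρω _ j (hJm j), div_self (hω j).ne']
  refine ⟨η, univ.sigma bad, ⟨fun i j => div_nonneg (hρ0 _ _ _) (hω j).le, hη1⟩,
    fun i => ?_, ?_, ?_, ?_⟩
  · unfold clusterWeight
    rw [hJ, hJ]
    refine Finset.sum_congr rfl fun l _ => ?_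
    rw [← hρπ l i]
    exact Finset.sum_congr rfl fun j hj => hηω l j hj i
  · rw [cost_one_eq, cost_one_eq, hJ,
      hJ fun j => ω j * ∑ i, ξ i j * sqNorm (z (line j) + t j • u (line j) - s i)]
    refine Finset.sum_le_sum fun l _ => ?_
    let F : Fin n → ℝ := fun j => sqNorm (z l + t j • u l)
    let H : Fin k → ℝ := fun i => ∑ c, (s i c ^ 2 - 2 * z l c * s i c)
    have hq : ∀ j i, sqNorm (z l + t j • u l - s i) = F j + H i - 2 * (t j * a l i) := by
      intro j i
      simp only [F, H, a, sqNorm, Finset.mul_sum]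
      rw [← Finset.sum_add_distrib, ← Finset.sum_sub_distrib]
      refine Finset.sum_congr rfl fun c _ => ?_
      simp only [Pi.sub_apply, Pi.add_apply, Pi.smul_apply, smul_eq_mul]
      ring
    have hexpand : ∀ (ζ τ : Fin k → Fin n → ℝ), (∀ j, ∑ i, ζ i j = 1) →
        (∀ j ∈ J l, ∀ i, ζ i j * ω j = τ i j) →
        ∑ j ∈ J l, ω j * ∑ i, ζ i j * sqNorm (z (line j) + t j • u (line j) - s i)
          = ∑ j ∈ J l, ω j * F j + ∑ i, H i * ∑ j ∈ J l, τ i j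
            - 2 * ∑ i, a l i * ∑ j ∈ J l, τ i j * t j := by
      intro ζ τ hζ hτ
      have e1 : ∑ j ∈ J l, ω j * F j = ∑ i, ∑ j ∈ J l, τ i j * F j := by
        rw [Finset.sum_comm]
        refine Finset.sum_congr rfl fun j hj => ?_
        rw [← Finset.sum_mul, ← Finset.sum_congr rfl fun i _ => hτ j hj i, ← Finset.sum_mul, hζ,
          one_mul]
      simp only [e1, Finset.mul_sum]
      rw [Finset.sum_comm, ← Finset.sum_add_distrib, ← Finset.sum_sub_distrib]
      refine Finset.sum_congr rfl fun i _ => ?_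
      rw [← Finset.sum_add_distrib, ← Finset.sum_sub_distrib]
      refine Finset.sum_congr rfl fun j hj => ?_
      rw [(mem_filter.1 hj).2, hq, ← hτ j hj i]
      ring
    rw [hexpand η (ρ l) hη1 (hηω l), hexpand ξ (fun i j => ξ i j * ω j) hξ.2 fun _ _ _ => rfl]
    simp only [hρπ l]
    linarith [hρle l]
  · rw [Finset.card_sigma]
    refine (Finset.sum_le_card_nsmul _ _ _ fun l _ => hbad l).trans ?_
    simp [Finset.card_univ]
  · intro j j' hl hgj hnot i
    have hnb : g j ∉ bad (line j) := fun h => hnot (mem_sigma.2 ⟨mem_univ _, h⟩)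
    have hgood : ∃ i, ∀ j' ∈ J (line j), g j' = g j → ∀ i', i' ≠ i → ρ (line j) i' j' = 0 := by
      by_contra hc
      exact hnb (mem_filter.2 ⟨mem_image_of_mem g (hJm j), hc⟩)
    obtain ⟨i0, hi0⟩ := hgood
    have hval : ∀ j' ∈ J (line j), g j' = g j → ∀ i, η i j' = if i = i0 then 1 else 0 := by
      intro j' hj' hg' i
      have hz : ∀ i', i' ≠ i0 → η i' j' = 0 := fun i' h => by
        have := hηω _ j' hj' i'
        rw [hi0 j' hj' hg' i' h] at this
        exact (mul_eq_zero.1 this).resolve_right (hω j').ne'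
      split_ifs with h
      · rw [h, ← hη1 j']
        exact (Finset.sum_eq_single i0 (fun i' _ h => hz i' h) (by simp)).symm
      · exact hz i h
    rw [hval j (hJm j) rfl, hval j' (by simp [J, hl]) hgj.symm]

/-- Every number in `[-1, 1]` is within `1 / N` of a point of the grid of mesh `1 / N`. -/
lemma exists_grid_approx {N : ℕ} (hN : 0 < N) {w : ℝ} (hw : |w| ≤ 1) :
    ∃ c : Fin (2 * N + 1), (w - ((c : ℕ) / N - 1 : ℝ)) ^ 2 ≤ 1 / (N : ℝ) ^ 2 := by
  have hN' : (0 : ℝ) < N := by exact_mod_cast hN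
  obtain ⟨h1, h2⟩ := abs_le.1 hw
  have h0 : 0 ≤ (w + 1) * N := mul_nonneg (by linarith) hN'.le
  have hlt : ⌊(w + 1) * N⌋₊ < 2 * N + 1 := by
    have : ⌊(w + 1) * N⌋₊ ≤ 2 * N := by
      refine Nat.floor_le_of_le ?_
      push_cast
      nlinarith
    omega
  refine ⟨⟨_, hlt⟩, ?_⟩
  have h3 := Nat.floor_le h0
  have h4 := (Nat.lt_floor_add_one ((w + 1) * N)).le
  set f : ℝ := (⌊(w + 1) * N⌋₊ : ℝ)
  have h5 : w - (f / N - 1) = ((w + 1) * N - f) / N := by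
    field_simp
    ring
  rw [h5, div_pow]
  refine div_le_div_of_nonneg_right ?_ (by positivity)
  nlinarith

/-- A family of `O(1 / δ ^ d)` directions in dimension `d + 1` such that every vector is
relatively `δ`-close to a multiple of one of them. -/
lemma exists_direction_net (d : ℕ) : ∃ C : ℝ, 0 < C ∧ ∀ δ : ℝ, 0 < δ → δ ≤ 1 →
    ∃ (m : ℕ) (u : Fin m → Fin (d + 1) → ℝ), (m : ℝ) ≤ C / δ ^ d ∧
      ∀ v : Fin (d + 1) → ℝ, ∃ (l : Fin m) (t : ℝ),
        sqNorm (v - t • u l) ≤ δ ^ 2 * sqNorm v ∧ sqNorm (t • u l) ≤ (d + 1) * sqNorm v := by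
  refine ⟨(d + 1) * (2 * d + 5) ^ d, by positivity, fun δ hδ hδ1 => ?_⟩
  set N := ⌈((d : ℝ) + 1) / δ⌉₊ with hNdef
  have hNle : ((d : ℝ) + 1) / δ ≤ N := Nat.le_ceil _
  have hNlt : (N : ℝ) < ((d : ℝ) + 1) / δ + 1 := Nat.ceil_lt_add_one (by positivity)
  have hNpos : (0 : ℝ) < N := lt_of_lt_of_le (by positivity) hNle
  have hN0 : 0 < N := by exact_mod_cast hNpos
  let D := Fin (d + 1) × (Fin d → Fin (2 * N + 1))
  let e : Fin (Fintype.card D) ≃ D := (Fintype.equivFin D).symm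
  let dir : D → Fin (d + 1) → ℝ := fun p =>
    Fin.insertNth (α := fun _ => ℝ) p.1 1 fun i => ((p.2 i : ℕ) / N - 1 : ℝ)
  refine ⟨Fintype.card D, fun l => dir (e l), ?_, fun v => ?_⟩
  · have h1 : (Fintype.card D : ℝ) = (d + 1) * (2 * N + 1 : ℝ) ^ d := by
      simp [D]
    have h2 : (2 * N + 1 : ℝ) ≤ (2 * d + 5) / δ := by
      have : 1 ≤ 1 / δ := by rwa [le_div_iff₀ hδ, one_mul]
      have h3 : (2 * d + 5 : ℝ) / δ = 2 * (((d : ℝ) + 1) / δ) + 3 * (1 / δ) := by ring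
      linarith
    rw [h1, mul_div_assoc, ← div_pow]
    gcongr
  · obtain ⟨c, -, hc⟩ := Finset.exists_max_image univ (fun i => |v i|) univ_nonempty
    have hc' : ∀ i, |v i| ≤ |v c| := fun i => hc i (mem_univ i)
    have hvc : v c ^ 2 ≤ sqNorm v :=
      Finset.single_le_sum (f := fun l => v l ^ 2) (fun _ _ => sq_nonneg _) (mem_univ c)
    have hw : ∀ i, |v i / v c| ≤ 1 := fun i => by
      rw [abs_div]
      exact div_le_one_of_le₀ (hc' i) (abs_nonneg _)
    have hvw : ∀ i, v i = v c * (v i / v c) := fun i => by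
      rcases eq_or_ne (v c) 0 with h | h
      · have := hc' i
        rw [h, abs_zero] at this
        rw [h, zero_mul]
        exact abs_eq_zero.1 (le_antisymm this (abs_nonneg _))
      · field_simp
    choose q hq using fun i : Fin d => exists_grid_approx hN0 (hw (c.succAbove i))
    refine ⟨e.symm (c, q), v c, ?_, ?_⟩
    · have h1 : sqNorm (v - v c • dir (e (e.symm (c, q))))
          = ∑ i : Fin d, v c ^ 2 *
            (v (c.succAbove i) / v c - ((q i : ℕ) / N - 1 : ℝ)) ^ 2 := by
        rw [sqNorm, Fin.sum_univ_succAbove _ c]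
        simp only [e.apply_symm_apply, dir, Pi.sub_apply, Pi.smul_apply, smul_eq_mul,
          Fin.insertNth_apply_same, Fin.insertNth_apply_succAbove]
        rw [mul_one, sub_self, zero_pow two_ne_zero, zero_add]
        refine Finset.sum_congr rfl fun i _ => ?_
        rw [← mul_pow, mul_sub (v c) (v (c.succAbove i) / v c), ← hvw]
      have h2 : (d : ℝ) * (1 / (N : ℝ) ^ 2) ≤ δ ^ 2 := by
        have h3 : (d : ℝ) + 1 ≤ N * δ := by rwa [div_le_iff₀ hδ] at hNle
        have hd : (0 : ℝ) ≤ d := Nat.cast_nonneg d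
        rw [mul_one_div, div_le_iff₀ (by positivity)]
        nlinarith
      rw [h1]
      calc _ ≤ ∑ _i : Fin d, v c ^ 2 * (1 / (N : ℝ) ^ 2) :=
            Finset.sum_le_sum fun i _ => mul_le_mul_of_nonneg_left (hq i) (sq_nonneg _)
        _ = (d * (1 / (N : ℝ) ^ 2)) * v c ^ 2 := by
            rw [Finset.sum_const, Finset.card_univ, Fintype.card_fin, nsmul_eq_mul]
            ring
        _ ≤ δ ^ 2 * sqNorm v := mul_le_mul h2 hvc (sq_nonneg _) (sq_nonneg _)
    · have h1 : sqNorm (v c • dir (e (e.symm (c, q))))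
          = v c ^ 2 + ∑ i : Fin d, v c ^ 2 * ((q i : ℕ) / N - 1 : ℝ) ^ 2 := by
        rw [sqNorm, Fin.sum_univ_succAbove _ c]
        simp only [e.apply_symm_apply, dir, Pi.smul_apply, smul_eq_mul,
          Fin.insertNth_apply_same, Fin.insertNth_apply_succAbove, mul_one, mul_pow]
      have h2 : ∀ i, ((q i : ℕ) / N - 1 : ℝ) ^ 2 ≤ 1 := fun i => by
        have h3 : ((q i : ℕ) : ℝ) ≤ 2 * N := by exact_mod_cast Nat.lt_succ_iff.1 (q i).isLt
        have h4 : ((q i : ℕ) : ℝ) / N ≤ 2 := by rwa [div_le_iff₀ hNpos]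
        have h5 : 0 ≤ ((q i : ℕ) : ℝ) / N := by positivity
        nlinarith
      rw [h1]
      calc _ ≤ v c ^ 2 + ∑ _i : Fin d, v c ^ 2 * 1 := by
            gcongr with i
            exact h2 i
        _ = (d + 1) * v c ^ 2 := by
            rw [Finset.sum_const, Finset.card_univ, Fintype.card_fin, nsmul_eq_mul]
            ring
        _ ≤ (d + 1) * sqNorm v := by gcongr

/-- Optimal centres for unconstrained clustering exist. -/
lemma exists_optimal_centres {d k n : ℕ} (hk : 0 < k) (x : Fin n → Fin d → ℝ) {ω : Fin n → ℝ}
    (hω : ∀ j, 0 < ω j) : ∃ (a : Fin n → Fin k) (z : Fin k → Fin d → ℝ),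
      ∀ (ξ : Fin k → Fin n → ℝ) (s : Fin k → Fin d → ℝ), IsClustering ξ →
        ∑ j, ω j * sqNorm (x j - z (a j))
          ≤ cost (fun _ : Fin k => (1 : Matrix (Fin d) (Fin d) ℝ)) x ω ξ s := by
  have : Nonempty (Fin k) := ⟨⟨0, hk⟩⟩
  let B : (Fin n → Fin k) → Fin k → Finset (Fin n) := fun a i => univ.filter fun j => a j = i
  let Φ : (Fin n → Fin k) → ℝ := fun a => ∑ i, scatter ω x (B a i)
  obtain ⟨a, -, ha⟩ := Finset.exists_min_image univ Φ univ_nonempty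
  refine ⟨a, fun i => centroidOn ω x (B a i), fun ξ s hξ => ?_⟩
  have h1 : ∑ j, ω j * sqNorm (x j - centroidOn ω x (B a (a j))) = Φ a := by
    rw [← Finset.sum_fiberwise univ a]
    refine Finset.sum_congr rfl fun i _ => Finset.sum_congr rfl fun j hj => ?_
    rw [(mem_filter.1 hj).2]
  choose b hb using fun j => Finset.exists_min_image univ
    (fun i : Fin k => sqNorm (x j - s i)) univ_nonempty
  have h2 : Φ b ≤ ∑ j, ω j * sqNorm (x j - s (b j)) := by
    rw [← Finset.sum_fiberwise univ b]
    refine Finset.sum_le_sum fun i _ => (scatter_le hω x _ (s i)).trans (le_of_eq ?_)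
    refine Finset.sum_congr rfl fun j hj => ?_
    rw [(mem_filter.1 hj).2]
  rw [h1, cost_one_eq]
  refine (ha b (mem_univ b)).trans (h2.trans (Finset.sum_le_sum fun j _ => ?_))
  refine mul_le_mul_of_nonneg_left ?_ (hω j).le
  calc sqNorm (x j - s (b j)) = ∑ i, ξ i j * sqNorm (x j - s (b j)) := by
        rw [← Finset.sum_mul, hξ.2, one_mul]
    _ ≤ _ := Finset.sum_le_sum fun i _ =>
        mul_le_mul_of_nonneg_left ((hb j).2 i (mem_univ i)) (hξ.1 i j)

/-- The points can be partitioned into `O(k ^ 2 / δ ^ (d + 2))` batches in dimension `d + 1` such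
that every assignment can be made constant on the batches at a relative loss of `O(δ)`. -/
lemma exists_good_partition (d : ℕ) : ∃ C : ℝ, 0 < C ∧ ∀ (k n : ℕ), 0 < k →
    ∀ (x : Fin n → Fin (d + 1) → ℝ) (ω : Fin n → ℝ), (∀ j, 0 < ω j) →
    ∀ δ : ℝ, 0 < δ → δ ≤ 1 / 8 → ∃ (m : ℕ) (g : Fin n → (Σ _ : Fin k × Fin m, ℕ)),
      ((univ.image g).card : ℝ) ≤ C * k ^ 2 / δ ^ (d + 2) ∧
      ∀ (s : Fin k → Fin (d + 1) → ℝ) (ξ : Fin k → Fin n → ℝ), IsClustering ξ →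
        ∃ η : Fin k → Fin n → ℝ, IsClustering η ∧
          (∀ i, clusterWeight ω η i = clusterWeight ω ξ i) ∧
          (∀ i j j', g j = g j' → η i j = η i j') ∧
          cost (fun _ : Fin k => (1 : Matrix (Fin (d + 1)) (Fin (d + 1)) ℝ)) x ω η s
            ≤ (1 + 9 * δ) *
              cost (fun _ : Fin k => (1 : Matrix (Fin (d + 1)) (Fin (d + 1)) ℝ)) x ω ξ s := by
  obtain ⟨C, hC, hnet⟩ := exists_direction_net d
  refine ⟨C * (1 + 4 * (d + 1)), by positivity, fun k n hk x ω hω δ hδ hδ8 => ?_⟩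
  obtain ⟨m, u, hm, hu⟩ := hnet δ hδ (by linarith)
  obtain ⟨a, z, hopt⟩ := exists_optimal_centres hk x hω
  choose dir t hclose hshort using fun j => hu (x j - z (a j))
  let L := Fin k × Fin m
  let line : Fin n → L := fun j => (a j, dir j)
  let zL : L → Fin (d + 1) → ℝ := fun l => z l.1
  let uL : L → Fin (d + 1) → ℝ := fun l => u l.2
  let p : Fin n → Fin (d + 1) → ℝ := fun j => zL (line j) + t j • uL (line j)
  let J : L → Finset (Fin n) := fun l => univ.filter fun j => line j = l
  let r : Fin n → ℕ := fun j => (Tuple.sort t).symm j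
  have hr : Function.Injective r := fun j j' h => (Tuple.sort t).symm.injective (Fin.ext h)
  have hrt : ∀ j j', r j ≤ r j' → t j ≤ t j' := fun j j' h => by
    simpa using Tuple.monotone_sort t (show (Tuple.sort t).symm j ≤ (Tuple.sort t).symm j' from h)
  set H := ∑ j, ω j * sqNorm (x j - z (a j)) with hH
  have hH0 : 0 ≤ H := Finset.sum_nonneg fun j _ => mul_nonneg (hω j).le (sqNorm_nonneg _)
  have hE : ∑ j, ω j * sqNorm (x j - p j) ≤ δ ^ 2 * H := by
    rw [hH, Finset.mul_sum]
    refine Finset.sum_le_sum fun j _ => ?_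
    have h1 : x j - p j = x j - z (a j) - t j • u (dir j) := by
      simp only [p, zL, uL, line]
      abel
    rw [h1]
    calc _ ≤ ω j * (δ ^ 2 * sqNorm (x j - z (a j))) :=
          mul_le_mul_of_nonneg_left (hclose j) (hω j).le
      _ = _ := by ring
  let h : L → Fin n → ℝ := fun l j => ω j * sqNorm (p j - zL l)
  have hh : ∀ l j, 0 ≤ h l j := fun l j => mul_nonneg (hω j).le (sqNorm_nonneg _)
  have hD : ∑ l, ∑ j ∈ J l, h l j ≤ (d + 1) * H := by
    have h1 : ∑ l, ∑ j ∈ J l, h l j = ∑ j, h (line j) j := by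
      rw [← Finset.sum_fiberwise univ line]
      refine Finset.sum_congr rfl fun l _ => Finset.sum_congr rfl fun j hj => ?_
      rw [(mem_filter.1 hj).2]
    rw [h1, hH, Finset.mul_sum]
    refine Finset.sum_le_sum fun j _ => ?_
    have h2 : p j - zL (line j) = t j • u (dir j) := by
      simp only [p, uL, line]
      abel
    simp only [h]
    rw [h2]
    calc _ ≤ ω j * ((d + 1) * sqNorm (x j - z (a j))) :=
          mul_le_mul_of_nonneg_left (hshort j) (hω j).le
      _ = _ := by ring
  have hDl : ∀ l, ∑ j ∈ J l, h l j ≤ (d + 1) * H := fun l =>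
    (Finset.single_le_sum (f := fun l => ∑ j ∈ J l, h l j)
      (fun l _ => Finset.sum_nonneg fun j _ => hh l j) (mem_univ l)).trans hD
  set Q : ℝ := (Fintype.card L : ℝ) * (k + 1) with hQ
  have hQ0 : 0 ≤ Q := by positivity
  set T := δ ^ 2 * H / Q with hTdef
  have hT : 0 ≤ T := by positivity
  have hbatch : ∀ l, ∃ (g : Fin n → ℕ) (b : ℕ), (∀ j ∈ J l, g j ≤ b) ∧
      (∀ j ∈ J l, ∀ j' ∈ J l, r j ≤ r j' → g j ≤ g j') ∧
      (∀ c, scatter ω p ((J l).filter fun j => g j = c) ≤ T) ∧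
      T * b ≤ 2 * ∑ j ∈ J l, h l j ∧ (H = 0 → b = 0) := by
    intro l
    by_cases hH0 : H = 0
    · refine ⟨fun _ => 0, 0, by simp, by simp, fun c => ?_, ?_, fun _ => rfl⟩
      · refine (scatter_le hω p _ (zL l)).trans (le_trans ?_ hT)
        refine (Finset.sum_le_sum_of_subset_of_nonneg (filter_subset _ _)
          fun j _ _ => hh l j).trans ((hDl l).trans ?_)
        rw [hH0, mul_zero]
      · simpa using Finset.sum_nonneg fun j (_ : j ∈ J l) => hh l j
    · obtain ⟨g, b, h1, h2, h3, h4⟩ := exists_greedy_batches r hr (scatter ω p) (h l)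
        (scatter_empty ω p) (scatter_singleton hω p) (fun B => scatter_le hω p B (zL l)) hT (J l)
      refine ⟨g, b, h1, h2, h3, h4.trans ?_, fun h => absurd h hH0⟩
      have := Finset.sum_le_sum_of_subset_of_nonneg (f := h l)
        (filter_subset (fun j => g j ≠ b) (J l)) fun j _ _ => hh l j
      linarith
  choose G b hGb hGmono hGT hTb hb0 using hbatch
  let g : Fin n → ℕ := fun j => G (line j) j
  have hJm : ∀ j, j ∈ J (line j) := fun j => by simp [J]
  refine ⟨m, fun j => ⟨line j, g j⟩, ?_, fun s ξ hξ => ?_⟩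
  · have hcard : (univ.image fun j => (⟨line j, g j⟩ : Σ _ : L, ℕ)).card
        ≤ ∑ l : L, (b l + 1) := by
      have hsub : (univ.image fun j => (⟨line j, g j⟩ : Σ _ : L, ℕ))
          ⊆ univ.sigma fun l => range (b l + 1) := by
        intro y hy
        obtain ⟨j, -, rfl⟩ := mem_image.1 hy
        exact mem_sigma.2 ⟨mem_univ _, mem_range.2 (Nat.lt_succ_of_le (hGb _ j (hJm j)))⟩
      refine (Finset.card_le_card hsub).trans ?_
      simp [Finset.card_sigma]
    have hcard' : ((univ.image fun j => (⟨line j, g j⟩ : Σ _ : L, ℕ)).card : ℝ)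
        ≤ ∑ l : L, (b l : ℝ) + Fintype.card L := by
      refine (Nat.cast_le.2 hcard).trans (le_of_eq ?_)
      push_cast
      rw [Finset.sum_add_distrib]
      simp [Finset.card_univ]
    have hL : (Fintype.card L : ℝ) = k * m := by simp [L]
    have hsum : ∑ l : L, (b l : ℝ) ≤ 2 * (d + 1) * Q / δ ^ 2 := by
      rcases hH0.eq_or_lt with h0 | hpos
      · rw [Finset.sum_eq_zero fun l _ => by rw [hb0 l h0.symm, Nat.cast_zero]]
        positivity
      rcases hQ0.eq_or_lt with hq | hq
      · have hc : (Fintype.card L : ℝ) = 0 := by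
          rcases mul_eq_zero.1 hq.symm with h | h
          · exact h
          · have : (0 : ℝ) ≤ k := Nat.cast_nonneg k
            linarith
        have : IsEmpty L := Fintype.card_eq_zero_iff.1 (by exact_mod_cast hc)
        rw [Finset.univ_eq_empty, Finset.sum_empty]
        positivity
      have hTpos : 0 < T := by positivity
      have h1 : T * ∑ l : L, (b l : ℝ) ≤ 2 * ((d + 1) * H) := by
        rw [Finset.mul_sum]
        refine (Finset.sum_le_sum fun l _ => hTb l).trans ?_
        rw [← Finset.mul_sum]
        linarith
      rw [← le_div_iff₀' hTpos] at h1
      refine h1.trans (le_of_eq ?_)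
      rw [hTdef]
      field_simp
    have hk1 : (1 : ℝ) ≤ k := by exact_mod_cast hk
    have hm0 : (0 : ℝ) ≤ m := Nat.cast_nonneg m
    have hδ2 : 1 ≤ 1 / δ ^ 2 := by
      rw [le_div_iff₀ (by positivity)]
      nlinarith
    have h1 : (k : ℝ) * m ≤ k ^ 2 * m * (1 / δ ^ 2) := by
      have : (k : ℝ) * m ≤ k ^ 2 * m := by nlinarith [mul_nonneg (by linarith : (0 : ℝ) ≤ k) hm0]
      have h2 : 0 ≤ (k : ℝ) ^ 2 * m := by positivity
      nlinarith
    have h2 : 2 * ((d : ℝ) + 1) * Q / δ ^ 2 ≤ 4 * (d + 1) * (k ^ 2 * m * (1 / δ ^ 2)) := by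
      have h3 : Q ≤ 2 * (k ^ 2 * m) := by
        rw [hQ, hL]
        nlinarith [mul_nonneg (by linarith : (0 : ℝ) ≤ k) hm0]
      calc 2 * ((d : ℝ) + 1) * Q / δ ^ 2 ≤ 2 * ((d : ℝ) + 1) * (2 * (k ^ 2 * m)) / δ ^ 2 := by
            gcongr
        _ = _ := by ring
    calc _ ≤ ∑ l : L, (b l : ℝ) + Fintype.card L := hcard'
      _ ≤ (1 + 4 * (d + 1)) * (k ^ 2 * m * (1 / δ ^ 2)) := by
          rw [hL]
          linarith
      _ ≤ (1 + 4 * (d + 1)) * (k ^ 2 * (C / δ ^ d) * (1 / δ ^ 2)) := by gcongr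
      _ = _ := by
          rw [pow_add]
          field_simp
  · obtain ⟨η₀, bad, hη₀, hw₀, hc₀, hbadc, hconst⟩ := exists_assignment_on_lines line zL uL t hr hrt
      hω g (fun j j' hl hjj' => by
        have := hGmono (line j) j (hJm j) j' (by simp [J, hl]) hjj'
        simpa only [g, hl] using this) s hξ
    obtain ⟨η, hη, hw, hηg, hcη⟩ := exists_average p hω (fun j => (⟨line j, g j⟩ : Σ _ : L, ℕ)) bad
      hη₀ (fun j j' hjj' hnb i => by
        obtain ⟨h1, h2⟩ := Sigma.mk.inj_iff.1 hjj'
        exact hconst j j' h1 (eq_of_heq h2) hnb i) s hδ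
    refine ⟨η, hη, fun i => (hw i).trans (hw₀ i), hηg, ?_⟩
    have hscat : ∑ y ∈ bad, scatter ω p (univ.filter fun j =>
        (⟨line j, g j⟩ : Σ _ : L, ℕ) = y) ≤ δ ^ 2 * H := by
      have h1 : ∀ y ∈ bad, scatter ω p (univ.filter fun j =>
          (⟨line j, g j⟩ : Σ _ : L, ℕ) = y) ≤ T := by
        rintro ⟨l, c⟩ -
        refine le_trans (le_of_eq ?_) (hGT l c)
        congr 1
        ext j
        simp only [J, g, mem_filter, mem_univ, true_and, Sigma.mk.injEq, heq_eq_eq]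
        refine and_congr_right fun hl => ?_
        rw [hl]
      refine (Finset.sum_le_card_nsmul _ _ _ h1).trans ?_
      rw [nsmul_eq_mul]
      have h2 : (bad.card : ℝ) ≤ Q := by
        rw [hQ]
        exact_mod_cast hbadc
      calc (bad.card : ℝ) * T ≤ Q * T := mul_le_mul_of_nonneg_right h2 hT
        _ ≤ δ ^ 2 * H := by
          rw [hTdef]
          rcases hQ0.eq_or_lt with hq | hq
          · rw [← hq, zero_mul]
            positivity
          · rw [mul_div_cancel₀ _ hq.ne']
    have hA := cost_one_move_le p x hω hξ s hδ
    have hD' := cost_one_move_le x p hω hη s hδ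
    have hHc := hopt ξ s hξ
    have hE' : ∑ j, ω j * sqNorm (p j - x j) ≤ δ ^ 2 * H := by
      simpa only [sqNorm_sub_comm] using hE
    set c := cost (fun _ : Fin k => (1 : Matrix (Fin (d + 1)) (Fin (d + 1)) ℝ)) x ω ξ s
    have hδ2c : δ ^ 2 * H ≤ δ ^ 2 * c := mul_le_mul_of_nonneg_left hHc (sq_nonneg δ)
    have hmul : ∀ (y e : ℝ), 0 ≤ y → e ≤ δ ^ 2 * H → (y + 1 / δ) * e ≤ (y * δ ^ 2 + δ) * c := by
      intro y e hy he
      calc (y + 1 / δ) * e ≤ (y + 1 / δ) * (δ ^ 2 * c) :=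
            mul_le_mul_of_nonneg_left (he.trans hδ2c) (by positivity)
        _ = _ := by
          field_simp
    have hc0 : 0 ≤ c := hH0.trans hHc
    have e1 := hmul 1 _ zero_le_one hE'
    have e2 := hmul 2 _ zero_le_two hscat
    have e3 := hmul 1 _ zero_le_one hE
    have hδc : 0 ≤ δ * c := mul_nonneg hδ.le hc0
    have hδδc : δ * (δ * c) ≤ 1 / 8 * (δ * c) := mul_le_mul_of_nonneg_right hδ8 hδc
    have f1 : cost (fun _ : Fin k => (1 : Matrix (Fin (d + 1)) (Fin (d + 1)) ℝ)) p ω η₀ s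
        ≤ (1 + 3 * δ) * c := by
      refine hc₀.trans (hA.trans ((add_le_add le_rfl e1).trans ?_))
      linarith
    have f2 : cost (fun _ : Fin k => (1 : Matrix (Fin (d + 1)) (Fin (d + 1)) ℝ)) p ω η s
        ≤ (1 + 6 * δ) * c := by
      have := mul_le_mul_of_nonneg_left f1 (by linarith : 0 ≤ 1 + δ)
      refine hcη.trans ((add_le_add this e2).trans ?_)
      linarith
    have := mul_le_mul_of_nonneg_left f2 (by linarith : 0 ≤ 1 + δ)
    refine hD'.trans ((add_le_add this e3).trans ?_)
    linarith

theorem statement12 (d : ℕ) :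
    ∃ c : ℝ, 0 < c ∧
      ∀ (k n : ℕ) (x : Fin n → Fin d → ℝ) (ω : Fin n → ℝ), (∀ j, 0 < ω j) →
      ∀ (κlo κhi : Fin k → ℝ), (∀ i, κlo i ≤ κhi i) →
        (∃ ξ, IsWCC κlo κhi ω ξ) →
        ∀ ε : ℝ, 0 < ε → ε ≤ 1 / 2 →
        ∃ (m : ℕ) (x' : Fin m → Fin d → ℝ) (ω' : Fin m → ℝ),
          (∀ j', 0 < ω' j') ∧
          (∃ f Δp Δm, IsCoresetWith ε 1 κlo κhi
            (fun _ : Fin k => (1 : Matrix (Fin d) (Fin d) ℝ)) x ω x' ω' f Δp Δm) ∧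
          (m : ℝ) ≤ c * (k : ℝ) ^ 2 / ε ^ (d + 1) := by
  rcases d with _ | d
  · refine ⟨1, one_pos, fun k n x ω hω κlo κhi _ hne ε hε hε2 => ?_⟩
    obtain ⟨x', ω', hω', hcore⟩ := exists_coreset_of_partition x hω κlo κhi hne hε
      (fun _ => ()) fun s ξ hξ => by
        obtain ⟨η, hη, hw, hc, -⟩ := exists_average x hω (fun _ => ()) univ hξ.1 (by simp) s one_pos
        refine ⟨η, ⟨hη, fun i => ?_⟩, hc, ?_⟩
        · rw [hw]
          exact hξ.2 i
        · simp [cost_one_eq, sqNorm]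
    refine ⟨_, x', ω', hω', hcore, ?_⟩
    rcases Nat.eq_zero_or_pos k with rfl | hk
    · obtain ⟨ξ, hξ⟩ := hne
      have : IsEmpty (Fin n) := ⟨fun j => by simpa using hξ.1.2 j⟩
      simp [Finset.univ_eq_empty]
    · have h1 : ((univ.image fun _ : Fin n => ()).card : ℝ) ≤ 1 := by
        exact_mod_cast Finset.card_le_one.2 fun _ _ _ _ => rfl
      have hk1 : (1 : ℝ) ≤ k := by exact_mod_cast hk
      refine h1.trans ?_
      rw [zero_add, pow_one, one_mul, le_div_iff₀ hε]
      nlinarith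
  · obtain ⟨C, hC, hpart⟩ := exists_good_partition d
    refine ⟨C * 9 ^ (d + 2), by positivity, fun k n x ω hω κlo κhi _ hne ε hε hε2 => ?_⟩
    rcases Nat.eq_zero_or_pos k with rfl | hk
    · have : IsEmpty (Fin n) := by
        obtain ⟨ξ, hξ⟩ := hne
        exact ⟨fun j => by simpa using hξ.1.2 j⟩
      obtain ⟨x', ω', hω', hcore⟩ := exists_coreset_of_partition x hω κlo κhi hne hε
        (fun _ => ()) fun s ξ hξ => ⟨ξ, hξ, fun i => i.elim0, by simp [cost]⟩
      refine ⟨_, x', ω', hω', hcore, ?_⟩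
      simp [Finset.univ_eq_empty]
    · obtain ⟨m, g, hcard, hg⟩ := hpart k n hk x ω hω (ε / 9) (by positivity) (by linarith)
      obtain ⟨x', ω', hω', hcore⟩ := exists_coreset_of_partition x hω κlo κhi hne hε g
        fun s ξ hξ => by
          obtain ⟨η, hη, hw, hc, hle⟩ := hg s ξ hξ.1
          refine ⟨η, ⟨hη, fun i => ?_⟩, hc, ?_⟩
          · rw [hw]
            exact hξ.2 i
          · rwa [mul_div_cancel₀ _ (by norm_num : (9 : ℝ) ≠ 0)] at hle
      refine ⟨_, x', ω', hω', hcore, hcard.trans (le_of_eq ?_)⟩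
      rw [div_pow]
      field_simp

end
end

section
/- Let n ≥ 2 and r ∈ (0,1/2). Let x_j = r·(cos(2πj/n), sin(2πj/n)) ∈ ℝ² for j ∈ [n], each with weight ω_j = 1, let k = 2 with weight bounds κ_1^- = κ_1^+ = n−1 and κ_2^- = κ_2^+ = 1, let both norm matrices be the 2×2 identity, fix j₀ ∈ [n], and let S₀ = (s_1,s_2) with s_1 = 0 and s_2 = (1/r)·x_{j₀}. Then cost_K(X,S₀) = (n−1)·r² + (1−r)², and the minimum is attained exactly by the clustering C with ξ_{2,j₀} = 1, ξ_{1,j} = 1 for all j ≠ j₀ (and all other entries 0); in particular the contribution Σ_{i=1}^2 ξ_{i,j₀}·‖x_{j₀} − s_i‖₂² of x_{j₀} to the optimal constrained cost equals (1−r)², so the sensitivity of x_{j₀} satisfies t_K(x_{j₀}) ≥ (1−r)²/((n−1)r² + (1−r)²). -/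
open Finset Matrix

noncomputable section

/-- A weighted mean of `d` with weights `p` is at least the minimum of `d`. -/
lemma le_sum_mul_of_sum_eq_one {ι : Type*} [Fintype ι] {p d : ι → ℝ} {c : ℝ}
    (hp : ∀ j, 0 ≤ p j) (hsum : ∑ j, p j = 1) (hd : ∀ j, c ≤ d j) :
    c ≤ ∑ j, p j * d j := by
  calc c = ∑ j, p j * c := by rw [← Finset.sum_mul, hsum, one_mul]
    _ ≤ ∑ j, p j * d j :=
      Finset.sum_le_sum fun j _ => mul_le_mul_of_nonneg_left (hd j) (hp j)

/-- If a weighted mean of `d` attains the strict minimum of `d` at `j₀`, all other weights vanish. -/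
lemma eq_zero_of_sum_mul_eq {ι : Type*} [Fintype ι] {p d : ι → ℝ} {j₀ : ι}
    (hp : ∀ j, 0 ≤ p j) (hsum : ∑ j, p j = 1) (hd : ∀ j, j ≠ j₀ → d j₀ < d j)
    (h : ∑ j, p j * d j = d j₀) {j : ι} (hj : j ≠ j₀) : p j = 0 := by
  have hle (i : ι) : 0 ≤ p i * (d i - d j₀) := by
    refine mul_nonneg (hp i) (sub_nonneg.2 ?_)
    rcases eq_or_ne i j₀ with rfl | hi
    · exact le_rfl
    · exact (hd i hi).le
  have hzero : ∑ i, p i * (d i - d j₀) = 0 := by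
    simp only [mul_sub, Finset.sum_sub_distrib]
    rw [← Finset.sum_mul, hsum, h]
    ring
  have := (Finset.sum_eq_zero_iff_of_nonneg fun i _ => hle i).1 hzero j (Finset.mem_univ j)
  exact (mul_eq_zero.1 this).resolve_right (sub_pos.2 (hd j hj)).ne'

/-- Distinct `n`-th roots of unity have angle difference with cosine less than one. -/
lemma cos_two_pi_div_sub_lt_one {n : ℕ} {a b : Fin n} (hab : a ≠ b) :
    Real.cos (2 * Real.pi * (a : ℝ) / n - 2 * Real.pi * (b : ℝ) / n) < 1 := by
  have hn : (0 : ℝ) < n := by exact_mod_cast a.pos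
  have ha : (a : ℝ) < n := by exact_mod_cast a.isLt
  have hb : (b : ℝ) < n := by exact_mod_cast b.isLt
  have ha0 : (0 : ℝ) ≤ (a : ℝ) := Nat.cast_nonneg _
  have hb0 : (0 : ℝ) ≤ (b : ℝ) := Nat.cast_nonneg _
  have hpi := Real.two_pi_pos
  have heq : 2 * Real.pi * (a : ℝ) / n - 2 * Real.pi * (b : ℝ) / n =
      2 * Real.pi * (((a : ℝ) - b) / n) := by ring
  have h1 : ((a : ℝ) - b) / n < 1 := by rw [div_lt_one hn]; linarith
  have h2 : -1 < ((a : ℝ) - b) / n := by rw [lt_div_iff₀ hn]; linarith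
  refine lt_of_le_of_ne (Real.cos_le_one _) fun h => hab ?_
  rw [heq, Real.cos_eq_one_iff_of_lt_of_lt (by nlinarith) (by nlinarith)] at h
  have h3 : (a : ℝ) - b = 0 := by
    simpa [hn.ne', Real.pi_ne_zero] using h
  exact Fin.ext (by exact_mod_cast sub_eq_zero.1 h3)

lemma cost_one {d k n : ℕ} (x : Fin n → Fin d → ℝ) (ξ : Fin k → Fin n → ℝ)
    (s : Fin k → Fin d → ℝ) :
    cost (fun _ => 1) x (fun _ => 1) ξ s =
      ∑ i, ∑ j, ξ i j * ((x j - s i) ⬝ᵥ (x j - s i)) := by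
  simp [cost, anormSq]

/-- The contribution of a single point is at most the whole cost. -/
lemma sum_mul_dotProduct_le_cost {d k n : ℕ} (x : Fin n → Fin d → ℝ) {ξ : Fin k → Fin n → ℝ}
    (hξ : IsClustering ξ) (s : Fin k → Fin d → ℝ) (j₀ : Fin n) :
    ∑ i, ξ i j₀ * ((x j₀ - s i) ⬝ᵥ (x j₀ - s i)) ≤
      cost (fun _ => 1) x (fun _ => 1) ξ s := by
  rw [cost_one]
  refine Finset.sum_le_sum fun i _ => Finset.single_le_sum
    (f := fun j => ξ i j * ((x j - s i) ⬝ᵥ (x j - s i))) (fun j _ => ?_) (Finset.mem_univ j₀)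
  exact mul_nonneg (hξ.1 i j) (Finset.sum_nonneg fun l _ => mul_self_nonneg _)

theorem statement13 (n : ℕ) (hn : 2 ≤ n) (r : ℝ) (hr : 0 < r ∧ r < 1 / 2)
    (x : Fin n → Fin 2 → ℝ)
    (hx : x = fun (j : Fin n) (i : Fin 2) =>
      if i = 0 then r * Real.cos (2 * Real.pi * (j : ℝ) / n)
      else r * Real.sin (2 * Real.pi * (j : ℝ) / n))
    (ω : Fin n → ℝ) (hω : ω = fun _ => 1)
    (κlo κhi : Fin 2 → ℝ)
    (hκlo : κlo 0 = (n : ℝ) - 1 ∧ κlo 1 = 1) (hκhi : κhi 0 = (n : ℝ) - 1 ∧ κhi 1 = 1)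
    (E : Fin 2 → Matrix (Fin 2) (Fin 2) ℝ) (hE : E = fun _ => 1)
    (j₀ : Fin n)
    (S₀ : Fin 2 → Fin 2 → ℝ) (hS₀ : S₀ 0 = (fun _ => (0 : ℝ)) ∧ S₀ 1 = r⁻¹ • x j₀)
    (ξ₀ : Fin 2 → Fin n → ℝ)
    (hξ₀ : ξ₀ = fun i j =>
      if (i = 0 ∧ j ≠ j₀) ∨ (i = 1 ∧ j = j₀) then 1 else 0) :
    assignCost κlo κhi E x ω S₀ = ((n : ℝ) - 1) * r ^ 2 + (1 - r) ^ 2 ∧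
    IsWCC κlo κhi ω ξ₀ ∧
    cost E x ω ξ₀ S₀ = ((n : ℝ) - 1) * r ^ 2 + (1 - r) ^ 2 ∧
    (∀ ξ, IsWCC κlo κhi ω ξ →
      cost E x ω ξ S₀ = ((n : ℝ) - 1) * r ^ 2 + (1 - r) ^ 2 → ξ = ξ₀) ∧
    (∑ i, ξ₀ i j₀ * ((x j₀ - S₀ i) ⬝ᵥ (x j₀ - S₀ i))) = (1 - r) ^ 2 ∧
    ∀ Cmin : (Fin 2 → Fin 2 → ℝ) → (Fin 2 → Fin n → ℝ),
      (∀ S : Fin 2 → Fin 2 → ℝ, IsWCC κlo κhi ω (Cmin S) ∧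
        cost E x ω (Cmin S) S = assignCost κlo κhi E x ω S) →
      (1 - r) ^ 2 / (((n : ℝ) - 1) * r ^ 2 + (1 - r) ^ 2) ≤
        sSup {v : ℝ | ∃ S : Fin 2 → Fin 2 → ℝ,
          v = (∑ i, Cmin S i j₀ * ((x j₀ - S i) ⬝ᵥ (x j₀ - S i))) /
            assignCost κlo κhi E x ω S} := by
  obtain ⟨hr0, hr2⟩ := hr
  subst hω hE
  have h0 (j : Fin n) : (x j - S₀ 0) ⬝ᵥ (x j - S₀ 0) = r ^ 2 := by
    rw [hS₀.1, hx]
    simp only [dotProduct, Fin.sum_univ_two, Pi.sub_apply]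
    simp only [if_true, one_ne_zero, if_false]
    linear_combination r ^ 2 * Real.cos_sq_add_sin_sq (2 * Real.pi * (j : ℝ) / n)
  have h1 (j : Fin n) : (x j - S₀ 1) ⬝ᵥ (x j - S₀ 1) = r ^ 2 + 1 -
      2 * r * Real.cos (2 * Real.pi * (j : ℝ) / n - 2 * Real.pi * (j₀ : ℝ) / n) := by
    rw [hS₀.2, hx, Real.cos_sub]
    simp only [dotProduct, Fin.sum_univ_two, Pi.sub_apply, Pi.smul_apply, smul_eq_mul]
    simp only [if_true, one_ne_zero, if_false, inv_mul_cancel_left₀ hr0.ne']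
    linear_combination r ^ 2 * Real.cos_sq_add_sin_sq (2 * Real.pi * (j : ℝ) / n) +
      Real.cos_sq_add_sin_sq (2 * Real.pi * (j₀ : ℝ) / n)
  have h1j₀ : (x j₀ - S₀ 1) ⬝ᵥ (x j₀ - S₀ 1) = (1 - r) ^ 2 := by
    rw [h1, sub_self, Real.cos_zero]
    ring
  have h1lt (j : Fin n) (hj : j ≠ j₀) :
      (x j₀ - S₀ 1) ⬝ᵥ (x j₀ - S₀ 1) < (x j - S₀ 1) ⬝ᵥ (x j - S₀ 1) := by
    rw [h1j₀, h1]
    nlinarith [cos_two_pi_div_sub_lt_one hj]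
  have h1le (j : Fin n) : (1 - r) ^ 2 ≤ (x j - S₀ 1) ⬝ᵥ (x j - S₀ 1) := by
    rcases eq_or_ne j j₀ with rfl | hj
    · exact h1j₀.ge
    · exact h1j₀ ▸ (h1lt j hj).le
  have hsum0 {ξ : Fin 2 → Fin n → ℝ} (hξ : IsWCC κlo κhi (fun _ => 1) ξ) :
      ∑ j, ξ 0 j = (n : ℝ) - 1 := by
    have := hξ.2 0
    simp only [clusterWeight, mul_one, hκlo.1, hκhi.1] at this
    exact le_antisymm this.2 this.1
  have hsum1 {ξ : Fin 2 → Fin n → ℝ} (hξ : IsWCC κlo κhi (fun _ => 1) ξ) :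
      ∑ j, ξ 1 j = 1 := by
    have := hξ.2 1
    simp only [clusterWeight, mul_one, hκlo.2, hκhi.2] at this
    exact le_antisymm this.2 this.1
  have hcost {ξ : Fin 2 → Fin n → ℝ} (hξ : IsWCC κlo κhi (fun _ => 1) ξ) :
      cost (fun _ => 1) x (fun _ => 1) ξ S₀ =
        ((n : ℝ) - 1) * r ^ 2 + ∑ j, ξ 1 j * ((x j - S₀ 1) ⬝ᵥ (x j - S₀ 1)) := by
    rw [cost_one, Fin.sum_univ_two]
    simp only [h0]
    rw [← Finset.sum_mul, hsum0 hξ]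
  have hξ₀0 (j : Fin n) : ξ₀ 0 j = if j = j₀ then 0 else 1 := by simp [hξ₀]
  have hξ₀1 (j : Fin n) : ξ₀ 1 j = if j = j₀ then 1 else 0 := by simp [hξ₀]
  have hcl : IsClustering ξ₀ := by
    refine ⟨fun i j => ?_, fun j => ?_⟩
    · rw [hξ₀]
      dsimp only
      split_ifs <;> norm_num
    · rw [Fin.sum_univ_two, hξ₀0, hξ₀1]
      split_ifs <;> norm_num
  have hs1 : ∑ j, ξ₀ 1 j = 1 := by simp [hξ₀1]
  have hs0 : ∑ j, ξ₀ 0 j = (n : ℝ) - 1 := by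
    have h (j : Fin n) : ξ₀ 0 j = 1 - ξ₀ 1 j := by
      have := hcl.2 j
      rw [Fin.sum_univ_two] at this
      linarith
    simp [h, hs1]
  have hwcc : IsWCC κlo κhi (fun _ => 1) ξ₀ := by
    refine ⟨hcl, Fin.forall_fin_two.2 ⟨?_, ?_⟩⟩
    · simp only [clusterWeight, mul_one, hs0, hκlo.1, hκhi.1, le_refl, and_self]
    · simp only [clusterWeight, mul_one, hs1, hκlo.2, hκhi.2, le_refl, and_self]
  have hcost₀ : cost (fun _ => 1) x (fun _ => 1) ξ₀ S₀ =
      ((n : ℝ) - 1) * r ^ 2 + (1 - r) ^ 2 := by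
    rw [hcost hwcc, ← h1j₀]
    simp [hξ₀1]
  have huniq (ξ : Fin 2 → Fin n → ℝ) (hξ : IsWCC κlo κhi (fun _ => 1) ξ)
      (h : cost (fun _ => 1) x (fun _ => 1) ξ S₀ = ((n : ℝ) - 1) * r ^ 2 + (1 - r) ^ 2) :
      ξ = ξ₀ := by
    rw [hcost hξ, ← h1j₀] at h
    have hz (j : Fin n) (hj : j ≠ j₀) : ξ 1 j = 0 :=
      eq_zero_of_sum_mul_eq (hξ.1.1 1) (hsum1 hξ) h1lt (add_left_cancel h) hj
    have h11 (j : Fin n) : ξ 1 j = ξ₀ 1 j := by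
      rw [hξ₀1]
      split_ifs with hj
      · rw [hj, ← hsum1 hξ]
        exact (Finset.sum_eq_single j₀ (fun i _ hi => hz i hi) (by simp)).symm
      · exact hz j hj
    funext i j
    revert i
    refine Fin.forall_fin_two.2 ⟨?_, h11 j⟩
    have ha := hξ.1.2 j
    have hb := hcl.2 j
    rw [Fin.sum_univ_two] at ha hb
    linarith [h11 j]
  have hassign : assignCost κlo κhi (fun _ => 1) x (fun _ => 1) S₀ =
      ((n : ℝ) - 1) * r ^ 2 + (1 - r) ^ 2 := by
    refine IsLeast.csInf_eq ⟨⟨ξ₀, hwcc, hcost₀.symm⟩, ?_⟩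
    rintro c ⟨ξ, hξ, rfl⟩
    rw [hcost hξ]
    gcongr
    exact le_sum_mul_of_sum_eq_one (hξ.1.1 1) (hsum1 hξ) h1le
  have hcontrib : ∑ i, ξ₀ i j₀ * ((x j₀ - S₀ i) ⬝ᵥ (x j₀ - S₀ i)) = (1 - r) ^ 2 := by
    rw [Fin.sum_univ_two, hξ₀0, hξ₀1, h1j₀]
    simp
  refine ⟨hassign, hwcc, hcost₀, huniq, hcontrib, fun Cmin hC => le_csSup ⟨1, ?_⟩ ⟨S₀, ?_⟩⟩
  · rintro v ⟨S, rfl⟩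
    have hle := sum_mul_dotProduct_le_cost x (hC S).1.1 S j₀
    rw [(hC S).2] at hle
    exact div_le_one_of_le₀ hle ((Finset.sum_nonneg fun i _ => mul_nonneg ((hC S).1.1.1 i j₀)
      (Finset.sum_nonneg fun l _ => mul_self_nonneg _)).trans hle)
  · rw [huniq (Cmin S₀) (hC S₀).1 ((hC S₀).2.trans hassign), hcontrib, hassign]


end
end

section
/- Let d ∈ ℕ, let x, c ∈ ℝ^d with x ≠ c, let ε₀ > 0, and let q ∈ ℝ^d with q ≠ 0 and ‖(x−c)/‖x−c‖₂ − q‖₂ ≤ ε₀. Let x̄ denote the orthogonal projection of x onto the line L = {c + t·q : t ∈ ℝ} (i.e., the point of L nearest to x in the Euclidean norm). Then ‖x − x̄‖₂ ≤ ε₀·‖x − c‖₂. -/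
open Finset Matrix

noncomputable section

theorem statement14 {d : ℕ} (x c : EuclideanSpace ℝ (Fin d)) (hxc : x ≠ c)
    (ε₀ : ℝ) (hε₀ : 0 < ε₀) (q : EuclideanSpace ℝ (Fin d)) (hq : q ≠ 0)
    (hclose : ‖(‖x - c‖⁻¹ • (x - c)) - q‖ ≤ ε₀)
    (xbar : EuclideanSpace ℝ (Fin d))
    (hmem : ∃ t : ℝ, xbar = c + t • q)
    (hnear : ∀ t : ℝ, ‖x - xbar‖ ≤ ‖x - (c + t • q)‖) :
    ‖x - xbar‖ ≤ ε₀ * ‖x - c‖ := by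
  have hr : ‖x - c‖ ≠ 0 := norm_ne_zero_iff.mpr (sub_ne_zero.mpr hxc)
  have hscale : x - (c + ‖x - c‖ • q) = ‖x - c‖ • (‖x - c‖⁻¹ • (x - c) - q) := by
    rw [smul_sub, smul_inv_smul₀ hr, sub_sub]
  calc ‖x - xbar‖ ≤ ‖x - (c + ‖x - c‖ • q)‖ := hnear _
    _ = ‖x - c‖ * ‖‖x - c‖⁻¹ • (x - c) - q‖ := by rw [hscale, norm_smul, norm_norm]
    _ ≤ ‖x - c‖ * ε₀ := by gcongr
    _ = ε₀ * ‖x - c‖ := mul_comm _ _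

end
end

section
/- Let d, k ∈ ℕ, c ∈ ℝ^d, q ∈ ℝ^d with q ≠ 0, and for each i ∈ [k] let s_i ∈ ℝ^d, σ_i ∈ ℝ, and A_i a symmetric positive definite d×d matrix. Define g_i : ℝ → ℝ by g_i(t) = (c + t·q − s_i)ᵀA_i(c + t·q − s_i) + σ_i, and assume that g_i ≠ g_ℓ as functions on ℝ whenever i ≠ ℓ. For i ∈ [k] let S_i = {t ∈ ℝ : g_i(t) ≤ g_ℓ(t) for all ℓ ∈ [k]}. Then each S_i has finitely many connected components, and if γ_i denotes the number of connected components of S_i, then Σ_{i=1}^k γ_i ≤ 2k − 1. -/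
open Finset Matrix

noncomputable section

/-- The points at which `f i` is minimal among all the `f l`. -/
def minimizationSet {ι : Type*} (f : ι → ℝ → ℝ) (i : ι) : Set ℝ :=
  {t | ∀ l, f i t ≤ f l t}

/-- The connected components of `S`. -/
def componentsIn (S : Set ℝ) : Set (Set ℝ) :=
  {T | ∃ t ∈ S, T = connectedComponentIn S t}

/-- The points of `S` that have a point of `S` to their left and are left endpoints of their
component of `S`. -/
def laterLeftEndpoints (S : Set ℝ) : Set ℝ :=
  {x | x ∈ S ∧ (∃ p ∈ S, p < x) ∧ ∃ᶠ y in nhdsWithin x (Set.Iio x), y ∉ S}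

theorem eq_of_mem_componentsIn {S C D : Set ℝ} (hC : C ∈ componentsIn S)
    (hD : D ∈ componentsIn S) {x : ℝ} (hxC : x ∈ C) (hxD : x ∈ D) : C = D := by
  obtain ⟨t, -, rfl⟩ := hC
  obtain ⟨u, -, rfl⟩ := hD
  rw [connectedComponentIn_eq hxC, connectedComponentIn_eq hxD]

theorem isClosed_of_mem_componentsIn {S C : Set ℝ} (hS : IsClosed S)
    (hC : C ∈ componentsIn S) : IsClosed C := by
  obtain ⟨t, ht, rfl⟩ := hC
  refine isClosed_of_closure_subset ?_
  exact isPreconnected_connectedComponentIn.closure.subset_connectedComponentIn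
    (subset_closure (mem_connectedComponentIn ht))
    (closure_minimal (connectedComponentIn_subset S t) hS)

theorem sInf_mem_laterLeftEndpoints {S C : Set ℝ} (hS : IsClosed S) (hC : C ∈ componentsIn S)
    (h : ∃ p ∈ S, ∀ x ∈ C, p < x) : sInf C ∈ C ∧ sInf C ∈ laterLeftEndpoints S := by
  obtain ⟨p, hp, hpC⟩ := h
  have hcl := isClosed_of_mem_componentsIn hS hC
  obtain ⟨t, ht, rfl⟩ := hC
  have hbdd : BddBelow (connectedComponentIn S t) := ⟨p, fun x hx => (hpC x hx).le⟩
  have hmem : sInf (connectedComponentIn S t) ∈ connectedComponentIn S t :=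
    hcl.csInf_mem ⟨t, mem_connectedComponentIn ht⟩ hbdd
  refine ⟨hmem, connectedComponentIn_subset S t hmem, ⟨p, hp, hpC _ hmem⟩, fun hev => ?_⟩
  simp only [not_not] at hev
  set x := sInf (connectedComponentIn S t) with hx
  obtain ⟨l, hl, hlS⟩ := mem_nhdsLT_iff_exists_Ioo_subset.1 hev
  have hlx : l < x := hl
  have hsub : Set.Ioc l x ⊆ S := by
    intro y hy
    rcases hy.2.lt_or_eq with h | h
    · exact hlS ⟨hy.1, h⟩
    · exact h ▸ connectedComponentIn_subset S t hmem
  have hIoc : Set.Ioc l x ⊆ connectedComponentIn S t := by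
    rw [connectedComponentIn_eq hmem]
    exact isPreconnected_Ioc.subset_connectedComponentIn ⟨hlx, le_rfl⟩ hsub
  have hle : x ≤ (l + x) / 2 := csInf_le hbdd (hIoc ⟨by linarith, by linarith⟩)
  linarith

theorem encard_componentsIn_le {S : Set ℝ} (hS : IsClosed S) :
    (componentsIn S).encard ≤ 1 + (laterLeftEndpoints S).encard := by
  set N : Set (Set ℝ) := {C | ∃ p ∈ S, ∀ x ∈ C, p < x}
  have hfirst : (componentsIn S \ N).encard ≤ 1 := by
    refine Set.encard_le_one_iff.2 fun C D hC hD => ?_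
    have first_le : ∀ {E}, E ∈ componentsIn S \ N → ∀ p ∈ S, ∃ x ∈ E, x ≤ p := by
      rintro E ⟨-, hE⟩ p hp
      by_contra! hcon
      exact hE ⟨p, hp, hcon⟩
    have subset : ∀ {E}, E ∈ componentsIn S → E ⊆ S ∧ E.Nonempty ∧ E.OrdConnected := by
      rintro E ⟨t, ht, rfl⟩
      exact ⟨connectedComponentIn_subset S t, ⟨t, mem_connectedComponentIn ht⟩,
        isPreconnected_connectedComponentIn.ordConnected⟩
    obtain ⟨hDS, ⟨p, hp⟩, hDc⟩ := subset hD.1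
    obtain ⟨x, hx, hxp⟩ := first_le hC p (hDS hp)
    obtain ⟨y, hy, hyx⟩ := first_le hD x ((subset hC.1).1 hx)
    exact eq_of_mem_componentsIn hC.1 hD.1 hx (hDc.out hy hp ⟨hyx, hxp⟩)
  have hlater : (componentsIn S ∩ N).encard ≤ (laterLeftEndpoints S).encard := by
    refine Set.encard_le_encard_of_injOn (f := sInf)
      (fun C hC => (sInf_mem_laterLeftEndpoints hS hC.1 hC.2).2) fun C hC D hD hCD => ?_
    refine eq_of_mem_componentsIn hC.1 hD.1 (sInf_mem_laterLeftEndpoints hS hC.1 hC.2).1 ?_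
    rw [hCD]
    exact (sInf_mem_laterLeftEndpoints hS hD.1 hD.2).1
  calc (componentsIn S).encard
      = (componentsIn S \ N ∪ componentsIn S ∩ N).encard := by rw [Set.sdiff_union_inter]
    _ ≤ _ := (Set.encard_union_le _ _).trans (add_le_add hfirst hlater)

section QuadraticFamily

variable {ι : Type*} {f m : ι → ℝ → ℝ} {a : ι → ℝ}

/-- `l` follows `i` in the order of slopes at `x` of the functions that agree with `f i` there. -/
def IsNextSlope (f m : ι → ℝ → ℝ) (i l : ι) (x : ℝ) : Prop :=
  f l x = f i x ∧ m i x < m l x ∧ ∀ j, f j x = f i x → m i x < m j x → m l x ≤ m j x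

theorem continuous_of_expansion
    (hf : ∀ i x t, f i t = f i x + m i x * (t - x) + a i * (t - x) ^ 2) (i : ι) :
    Continuous (f i) := by
  have h : f i = fun t => f i 0 + m i 0 * (t - 0) + a i * (t - 0) ^ 2 := funext fun t => hf i 0 t
  rw [h]
  fun_prop

theorem exists_isNextSlope [Finite ι]
    (hf : ∀ i x t, f i t = f i x + m i x * (t - x) + a i * (t - x) ^ 2)
    {i : ι} {x : ℝ} (hx : x ∈ laterLeftEndpoints (minimizationSet f i)) :
    ∃ l, IsNextSlope f m i l x := by
  obtain ⟨hxS, ⟨p, hpS, hpx⟩, hfreq⟩ := hx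
  have hne : {l | f l x = f i x ∧ m i x < m l x}.Nonempty := by
    by_contra hempty
    have hslope : ∀ l, f l x = f i x → m l x ≤ m i x := fun l hl => by
      by_contra! h
      exact hempty ⟨l, hl, h⟩
    refine hfreq ?_
    simp only [not_not, minimizationSet, Set.mem_ofPred_eq]
    refine Filter.eventually_all.2 fun l => ?_
    have hcont := continuous_of_expansion hf
    rcases (hxS l).lt_or_eq with h | h
    · exact (((hcont i).continuousAt.eventually_lt (hcont l).continuousAt h).mono
        fun t ht => ht.le).filter_mono nhdsWithin_le_nhds
    · have hmem : Set.Ioo p x ∈ nhdsWithin x (Set.Iio x) := Ioo_mem_nhdsLT hpx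
      rcases (hslope l h.symm).lt_or_eq with h' | h'
      · have hlin : ∀ᶠ t in nhds x, m l x - m i x + (a l - a i) * (t - x) < 0 := by
          refine ContinuousAt.eventually_lt (by fun_prop) continuousAt_const ?_
          simpa using h'
        filter_upwards [hmem, hlin.filter_mono nhdsWithin_le_nhds] with t ht hlt
        rw [hf i x t, hf l x t]
        nlinarith [mul_pos_of_neg_of_neg hlt (sub_neg.2 ht.2)]
      · have hp := hpS l
        rw [hf i x p, hf l x p, h, h'] at hp
        have hal : a i ≤ a l :=
          le_of_mul_le_mul_right (by linarith) (sq_pos_of_neg (sub_neg.2 hpx))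
        filter_upwards with t
        rw [hf i x t, hf l x t, h, h']
        gcongr
  obtain ⟨l, hl, hmin⟩ := Set.exists_min_image _ (fun l => m l x) (Set.toFinite _) hne
  exact ⟨l, hl.1, hl.2, fun j hj hij => hmin j ⟨hj, hij⟩⟩

theorem IsNextSlope.isGreatest
    (hf : ∀ i x t, f i t = f i x + m i x * (t - x) + a i * (t - x) ^ 2)
    {i l : ι} {x : ℝ} (hx : x ∈ laterLeftEndpoints (minimizationSet f i))
    (h : IsNextSlope f m i l x) : IsGreatest (minimizationSet f l) x := by
  obtain ⟨hxS, ⟨p, hpS, hpx⟩, -⟩ := hx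
  refine ⟨fun j => h.1 ▸ hxS j, fun t ht => ?_⟩
  by_contra! hxt
  have hp := hpS l
  have htl := ht i
  rw [hf i x p, hf l x p, h.1] at hp
  rw [hf i x t, hf l x t, h.1] at htl
  have h1 : 0 ≤ (x - p) * ((a l - a i) * (x - p) - (m l x - m i x)) := by linarith
  have h2 : (t - x) * ((m l x - m i x) + (a l - a i) * (t - x)) ≤ 0 := by linarith
  have h3 := nonneg_of_mul_nonneg_right h1 (sub_pos.2 hpx)
  have h4 := nonpos_of_mul_nonpos_right h2 (sub_pos.2 hxt)
  have hslope := h.2.1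
  have h5 : 0 < a l - a i := pos_of_mul_pos_left (b := x - p) (by linarith) (by linarith)
  have h6 := mul_pos h5 (sub_pos.2 hxt)
  linarith

theorem slope_ne_of_mem_laterLeftEndpoints (hinj : Function.Injective f)
    (hf : ∀ i x t, f i t = f i x + m i x * (t - x) + a i * (t - x) ^ 2)
    {i j : ι} (hij : i ≠ j) {x : ℝ} (hi : x ∈ laterLeftEndpoints (minimizationSet f i))
    (hj : x ∈ laterLeftEndpoints (minimizationSet f j)) : m i x ≠ m j x := by
  intro hm
  have hx : f i x = f j x := le_antisymm (hi.1 j) (hj.1 i)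
  have coeff_le : ∀ {u v : ι}, f u x = f v x → m u x = m v x →
      x ∈ laterLeftEndpoints (minimizationSet f u) → a u ≤ a v := by
    rintro u v hu hm ⟨-, ⟨p, hpS, hpx⟩, -⟩
    have hp := hpS v
    rw [hf u x p, hf v x p, hu, hm] at hp
    exact le_of_mul_le_mul_right (by linarith) (sq_pos_of_neg (sub_neg.2 hpx))
  have ha := le_antisymm (coeff_le hx hm hi) (coeff_le hx.symm hm.symm hj)
  exact hij (hinj (funext fun t => by rw [hf i x t, hf j x t, hx, hm, ha]))

theorem IsNextSlope.eq (hinj : Function.Injective f)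
    (hf : ∀ i x t, f i t = f i x + m i x * (t - x) + a i * (t - x) ^ 2)
    {i j l : ι} {x : ℝ} (hi : x ∈ laterLeftEndpoints (minimizationSet f i))
    (hj : x ∈ laterLeftEndpoints (minimizationSet f j))
    (hil : IsNextSlope f m i l x) (hjl : IsNextSlope f m j l x) : i = j := by
  by_contra hij
  rcases (slope_ne_of_mem_laterLeftEndpoints hinj hf hij hi hj).lt_or_gt with h | h
  · exact (hil.2.2 j (hjl.1.symm.trans hil.1) h).not_gt hjl.2.1
  · exact (hjl.2.2 i (hil.1.symm.trans hjl.1) h).not_gt hil.2.1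

theorem exists_not_bddAbove_minimizationSet [Finite ι] [Nonempty ι] (f : ι → ℝ → ℝ) :
    ∃ i, ¬ BddAbove (minimizationSet f i) := by
  by_contra! h
  choose B hB using h
  obtain ⟨M, hM⟩ := Set.finite_range B |>.bddAbove
  obtain ⟨i, hi⟩ := Finite.exists_min fun i => f i (M + 1)
  have h1 : M + 1 ≤ B i := hB i hi
  have h2 : B i ≤ M := hM ⟨i, rfl⟩
  linarith

theorem finite_laterLeftEndpoints_and_sum_ncard_lt [Fintype ι] [Nonempty ι]
    (hinj : Function.Injective f)
    (hf : ∀ i x t, f i t = f i x + m i x * (t - x) + a i * (t - x) ^ 2) :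
    (∀ i, (laterLeftEndpoints (minimizationSet f i)).Finite) ∧
      ∑ i, (laterLeftEndpoints (minimizationSet f i)).ncard < Fintype.card ι := by
  obtain ⟨c, hc⟩ := exists_not_bddAbove_minimizationSet f
  have hex : ∀ z : Σ i, laterLeftEndpoints (minimizationSet f i),
      ∃ l, IsNextSlope f m z.1 l z.2 := fun z => exists_isNextSlope hf z.2.2
  choose φ hφ using hex
  have hφc : ∀ z, φ z ≠ c := fun z hz => hc (hz ▸ ((hφ z).isGreatest hf z.2.2).bddAbove)
  have hφinj : Function.Injective φ := by
    rintro ⟨i, x, hx⟩ ⟨j, y, hy⟩ h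
    have hi := hφ ⟨i, x, hx⟩
    have hj := hφ ⟨j, y, hy⟩
    rw [← h] at hj
    obtain rfl : x = y := (hi.isGreatest hf hx).unique (hj.isGreatest hf hy)
    obtain rfl : i = j := hi.eq hinj hf hx hy hj
    rfl
  have : Finite (Σ i, laterLeftEndpoints (minimizationSet f i)) := Finite.of_injective φ hφinj
  have hfin : ∀ i, Finite (laterLeftEndpoints (minimizationSet f i)) := fun i =>
    Finite.of_injective (fun x => φ ⟨i, x⟩) (hφinj.comp sigma_mk_injective)
  refine ⟨fun i => Set.toFinite _, ?_⟩
  have := Fintype.ofFinite (Σ i, laterLeftEndpoints (minimizationSet f i))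
  have hcard := Fintype.card_lt_of_injective_of_notMem φ hφinj (b := c)
    (by rintro ⟨z, hz⟩; exact hφc z hz)
  rw [← Nat.card_eq_fintype_card, Nat.card_sigma] at hcard
  simpa only [Nat.card_coe_set_eq] using hcard

theorem finite_componentsIn_and_sum_ncard_le [Fintype ι] (hinj : Function.Injective f)
    (hf : ∀ i x t, f i t = f i x + m i x * (t - x) + a i * (t - x) ^ 2) :
    (∀ i, (componentsIn (minimizationSet f i)).Finite) ∧
      ∑ i, (componentsIn (minimizationSet f i)).ncard ≤ 2 * Fintype.card ι - 1 := by
  cases isEmpty_or_nonempty ι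
  · simp
  obtain ⟨hfin, hsum⟩ := finite_laterLeftEndpoints_and_sum_ncard_lt hinj hf
  have hcont := continuous_of_expansion hf
  have hclosed : ∀ i, IsClosed (minimizationSet f i) := fun i => by
    simp only [minimizationSet, Set.ofPred_forall]
    exact isClosed_iInter fun l => isClosed_le (hcont i) (hcont l)
  have hle := fun i => encard_componentsIn_le (hclosed i)
  have hfin' : ∀ i, (componentsIn (minimizationSet f i)).Finite := fun i => by
    refine Set.finite_of_encard_le_coe
      (k := 1 + (laterLeftEndpoints (minimizationSet f i)).ncard) ((hle i).trans_eq ?_)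
    rw [← (hfin i).cast_ncard_eq]
    push_cast
    rfl
  refine ⟨hfin', ?_⟩
  have hle' : ∀ i, (componentsIn (minimizationSet f i)).ncard
      ≤ 1 + (laterLeftEndpoints (minimizationSet f i)).ncard := fun i => by
    have h := hle i
    rw [← (hfin i).cast_ncard_eq, ← (hfin' i).cast_ncard_eq] at h
    exact_mod_cast h
  have hsum' := Finset.sum_le_sum fun i (_ : i ∈ Finset.univ) => hle' i
  rw [Finset.sum_add_distrib, Finset.sum_const, Finset.card_univ, smul_eq_mul] at hsum'
  omega

end QuadraticFamily

theorem quadraticForm_line_expansion {n : Type*} [Fintype n] (M : Matrix n n ℝ)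
    (c q s : n → ℝ) (σ x t : ℝ) :
    (c + t • q - s) ⬝ᵥ M.mulVec (c + t • q - s) + σ
      = (c + x • q - s) ⬝ᵥ M.mulVec (c + x • q - s) + σ
        + (q ⬝ᵥ M.mulVec (c + x • q - s) + (c + x • q - s) ⬝ᵥ M.mulVec q) * (t - x)
        + (q ⬝ᵥ M.mulVec q) * (t - x) ^ 2 := by
  have h : c + t • q - s = (c + x • q - s) + (t - x) • q := by
    rw [sub_smul]
    abel
  rw [h]
  simp only [mulVec_add, mulVec_smul, add_dotProduct, dotProduct_add, smul_dotProduct,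
    dotProduct_smul, smul_eq_mul]
  ring

theorem statement15 {d k : ℕ} (c q : Fin d → ℝ) (hq : q ≠ 0)
    (s : Fin k → Fin d → ℝ) (σ : Fin k → ℝ)
    (A : Fin k → Matrix (Fin d) (Fin d) ℝ) (hA : ∀ i, (A i).PosDef)
    (g : Fin k → ℝ → ℝ)
    (hg : g = fun i t => (c + t • q - s i) ⬝ᵥ (A i).mulVec (c + t • q - s i) + σ i)
    (hdist : ∀ i l, i ≠ l → g i ≠ g l)
    (S : Fin k → Set ℝ)
    (hS : S = fun i => {t : ℝ | ∀ l, g i t ≤ g l t}) :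
    (∀ i, {T : Set ℝ | ∃ t ∈ S i, T = connectedComponentIn (S i) t}.Finite) ∧
    ∑ i, {T : Set ℝ | ∃ t ∈ S i, T = connectedComponentIn (S i) t}.ncard ≤ 2 * k - 1 := by
  subst hS
  have h := finite_componentsIn_and_sum_ncard_le (f := g)
    (m := fun i x => q ⬝ᵥ (A i).mulVec (c + x • q - s i)
      + (c + x • q - s i) ⬝ᵥ (A i).mulVec q)
    (a := fun i => q ⬝ᵥ (A i).mulVec q)
    (fun i l hil => not_imp_not.1 (hdist i l) hil)
    (fun i x t => by
      subst hg
      exact quadraticForm_line_expansion (A i) c q (s i) (σ i) x t)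
  rw [Fintype.card_fin] at h
  exact h

end
end

section
/- Let d, k ∈ ℕ, c ∈ ℝ^d, q ∈ ℝ^d with q ≠ 0, and for each i ∈ [k] let s_i ∈ ℝ^d, σ_i ∈ ℝ, and A_i a symmetric positive definite d×d matrix. Define g_i : ℝ → ℝ by g_i(t) = (c + t·q − s_i)ᵀA_i(c + t·q − s_i) + σ_i, assume g_i ≠ g_ℓ as functions on ℝ whenever i ≠ ℓ, and set S_i = {t ∈ ℝ : g_i(t) ≤ g_ℓ(t) for all ℓ ∈ [k]}. Then there exist m ≤ 2k − 1 and a partition of ℝ into m nonempty intervals I_1,…,I_m such that for each j ∈ [m] there is exactly one i ∈ [k] with int(I_j) ⊆ S_i, and moreover int(I_j) ∩ S_ℓ = ∅ for every ℓ ≠ i. -/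
open Finset Matrix

noncomputable section

open scoped Topology

/-- The points where the minimum of the functions `g i`, `i ∈ T`, is attained at least twice. -/
def tiePoints {ι : Type*} (g : ι → ℝ → ℝ) (T : Finset ι) : Set ℝ :=
  {t | ∃ i ∈ T, ∃ l ∈ T, i ≠ l ∧ (∀ m ∈ T, g i t ≤ g m t) ∧ g l t = g i t}

theorem quadratic_eq_zero_of_nonpos_of_interior_zero {α β γ x y z : ℝ} (hα : 0 ≤ α)
    (hxy : x < y) (hyz : y < z) (hx : α * x ^ 2 + β * x + γ ≤ 0)
    (hy : α * y ^ 2 + β * y + γ = 0) (hz : α * z ^ 2 + β * z + γ ≤ 0) :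
    α = 0 ∧ β = 0 ∧ γ = 0 := by
  have hα0 : α = 0 := by
    by_contra h
    have hpos : 0 < α * ((z - x) * (z - y) * (y - x)) :=
      mul_pos (hα.lt_of_ne' h)
        (mul_pos (mul_pos (by linarith) (by linarith)) (by linarith))
    nlinarith [mul_nonneg (sub_nonneg.2 hyz.le) (neg_nonneg.2 hx),
      mul_nonneg (sub_nonneg.2 hxy.le) (neg_nonneg.2 hz),
      congrArg (fun r => (z - x) * r) hy]
  subst hα0
  have hβ0 : β = 0 := by
    apply le_antisymm
    · by_contra! h
      nlinarith [mul_pos h (sub_pos.2 hyz)]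
    · by_contra! h
      nlinarith [mul_pos (neg_pos.2 h) (sub_pos.2 hxy)]
  subst hβ0
  exact ⟨rfl, rfl, by linarith⟩

theorem encard_le_two_of_no_three_lt {Z : Set ℝ}
    (h : ∀ x ∈ Z, ∀ y ∈ Z, ∀ z ∈ Z, x < y → y < z → False) : Z.encard ≤ 2 := by
  by_contra! hlt
  have h3 : (3 : ℕ∞) ≤ Z.encard := by
    simpa [one_add_one_eq_two, two_add_one_eq_three] using Order.add_one_le_of_lt hlt
  obtain ⟨t, ht, hc⟩ := Set.exists_subset_encard_eq h3
  obtain ⟨x, y, z, hxy, hxz, hyz, rfl⟩ := Set.encard_eq_three.1 hc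
  have hx : x ∈ Z := ht (by simp)
  have hy : y ∈ Z := ht (by simp)
  have hz : z ∈ Z := ht (by simp)
  rcases hxy.lt_or_gt with h1 | h1 <;> rcases hxz.lt_or_gt with h2 | h2 <;>
    rcases hyz.lt_or_gt with h3 | h3 <;> grind

theorem encard_tiePoints_le {ι : Type*} [DecidableEq ι] (g : ι → ℝ → ℝ) (α β γ : ι → ℝ)
    (hg : ∀ i t, g i t = α i * t ^ 2 + β i * t + γ i) (hinj : Function.Injective g)
    (T : Finset ι) : (tiePoints g T).encard ≤ (2 * (T.card - 1) : ℕ) := by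
  induction T using Finset.induction_on_max_value α with
  | empty => simp [tiePoints]
  | insert a T ha hmax ih =>
    rcases T.eq_empty_or_nonempty with rfl | hT
    · have h_empty : tiePoints g (insert a (∅ : Finset ι)) = ∅ := by
        ext t
        simp +contextual [tiePoints]
      rw [h_empty]
      simp
    set Z : Set ℝ := {t | (∃ l ∈ T, g l t = g a t) ∧ ∀ m ∈ T, g a t ≤ g m t} with hZ
    have hsub : tiePoints g (insert a T) ⊆ tiePoints g T ∪ Z := by
      rintro t ⟨i, hi, l, hl, hil, hmin, heq⟩
      rcases Finset.mem_insert.1 hi with rfl | hiT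
      · exact Or.inr ⟨⟨l, Finset.mem_of_mem_insert_of_ne hl hil.symm, heq⟩,
          fun m hm => hmin m (Finset.mem_insert_of_mem hm)⟩
      rcases Finset.mem_insert.1 hl with rfl | hlT
      · exact Or.inr ⟨⟨i, hiT, heq.symm⟩,
          fun m hm => heq.trans_le (hmin m (Finset.mem_insert_of_mem hm))⟩
      · exact Or.inl ⟨i, hiT, l, hlT, hil, fun m hm => hmin m (Finset.mem_insert_of_mem hm), heq⟩
    have hZcard : Z.encard ≤ 2 := by
      apply encard_le_two_of_no_three_lt
      rintro x ⟨-, hx⟩ y ⟨⟨l, hl, hly⟩, -⟩ z ⟨-, hz⟩ hxy hyz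
      have hxl := hx l hl
      have hzl := hz l hl
      rw [hg, hg] at hxl hly hzl
      obtain ⟨h1, h2, h3⟩ := quadratic_eq_zero_of_nonpos_of_interior_zero
        (α := α a - α l) (β := β a - β l) (γ := γ a - γ l)
        (sub_nonneg.2 (hmax l hl)) hxy hyz (by linarith) (by linarith) (by linarith)
      have hal : a = l := hinj <| funext fun t => by
        rw [hg, hg, sub_eq_zero.1 h1, sub_eq_zero.1 h2, sub_eq_zero.1 h3]
      exact ha (hal ▸ hl)
    calc (tiePoints g (insert a T)).encard ≤ (tiePoints g T ∪ Z).encard := Set.encard_le_encard hsub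
      _ ≤ (tiePoints g T).encard + Z.encard := Set.encard_union_le _ _
      _ ≤ (2 * (T.card - 1) : ℕ) + 2 := add_le_add ih hZcard
      _ = (2 * ((insert a T).card - 1) : ℕ) := by
        have := hT.card_pos
        rw [Finset.card_insert_of_notMem ha,
          show 2 * (T.card + 1 - 1) = 2 * (T.card - 1) + 2 by omega]
        rfl

/-- A finite set of `n` reals cuts the line into `n + 1` nondegenerate intervals. -/
theorem exists_interval_partition (F : Finset ℝ) :
    ∃ I : Fin (F.card + 1) → Set ℝ,
      (∀ a, (I a).OrdConnected ∧ (interior (I a)).Nonempty ∧ Disjoint (interior (I a)) F) ∧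
      Pairwise (Function.onFun Disjoint I) ∧ (⋃ a, I a) = Set.univ := by
  set N : ℝ → ℕ := fun t => (F.filter (· ≤ t)).card with hN
  have hmono : Monotone N := fun x y hxy => Finset.card_le_card
    (Finset.monotone_filter_right F fun z _ hz => le_trans hz hxy)
  refine ⟨fun a => N ⁻¹' {(a : ℕ)}, fun a => ⟨?_, ?_, ?_⟩, ?_, ?_⟩
  · exact Set.OrdConnected.preimage_mono Set.ordConnected_singleton hmono
  · obtain ⟨t, ht⟩ : ∃ t, N t = a := by
      rcases Nat.eq_zero_or_pos (a : ℕ) with h0 | h0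
      · obtain ⟨b, hb⟩ := F.bddBelow
        refine ⟨b - 1, ?_⟩
        rw [h0, Finset.card_eq_zero, Finset.filter_eq_empty_iff]
        intro x hx hxb
        linarith [hb hx]
      · have hlt : (a : ℕ) - 1 < F.card := by omega
        set e := F.orderEmbOfFin rfl
        refine ⟨e ⟨a - 1, hlt⟩, ?_⟩
        have himg : F.filter (· ≤ e ⟨a - 1, hlt⟩) =
            (Finset.Iic ⟨a - 1, hlt⟩).map e.toEmbedding := by
          ext x
          simp only [Finset.mem_filter, Finset.mem_map, Finset.mem_Iic]
          constructor
          · rintro ⟨hx, hle⟩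
            obtain ⟨i, rfl⟩ : x ∈ Set.range e := by
              rw [Finset.range_orderEmbOfFin]
              exact hx
            exact ⟨i, e.le_iff_le.1 hle, rfl⟩
          · rintro ⟨i, hi, rfl⟩
            exact ⟨Finset.orderEmbOfFin_mem F rfl i, e.le_iff_le.2 hi⟩
        simp only [hN]
        rw [himg, Finset.card_map, Fin.card_Iic]
        simp only
        omega
    have hev : ∀ᶠ y in 𝓝[≥] t, ∀ x ∈ F, t < x → y < x :=
      (Filter.eventually_all_finset F).2 fun x _ =>
        Filter.eventually_all.2 fun hx => mem_nhdsWithin_of_mem_nhds (Iio_mem_nhds hx)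
    obtain ⟨u, htu, hu⟩ := mem_nhdsGE_iff_exists_Ico_subset.1 hev
    have hsub : Set.Ioo t u ⊆ N ⁻¹' {(a : ℕ)} := by
      intro y hy
      rw [Set.mem_preimage, Set.mem_singleton_iff, ← ht]
      refine congrArg Finset.card (Finset.filter_congr fun x hx => ?_)
      refine ⟨fun hxy => ?_, fun hxt => hxt.trans hy.1.le⟩
      by_contra! h
      exact (hu ⟨hy.1.le, hy.2⟩ x hx h).not_ge hxy
    exact (Set.nonempty_Ioo.2 htu).mono (interior_maximal hsub isOpen_Ioo)
  · rw [Set.disjoint_left]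
    intro x hx hxF
    obtain ⟨y, hyx, hy⟩ := exists_Ioc_subset_of_mem_nhds (isOpen_interior.mem_nhds hx) (exists_lt x)
    obtain ⟨w, hyw, hwx⟩ := exists_between hyx
    have hw : w ∈ N ⁻¹' {(a : ℕ)} := interior_subset (hy ⟨hyw, hwx.le⟩)
    have hx' : x ∈ N ⁻¹' {(a : ℕ)} := interior_subset hx
    refine (Eq.trans hw (Eq.symm hx')).not_lt (Finset.card_lt_card ?_)
    rw [Finset.ssubset_iff_of_subset
      (Finset.monotone_filter_right F fun z _ hz => le_trans hz hwx.le)]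
    exact ⟨x, Finset.mem_filter.2 ⟨hxF, le_rfl⟩, fun h => (Finset.mem_filter.1 h).2.not_gt hwx⟩
  · intro a b hab
    rw [Function.onFun, Set.disjoint_left]
    intro t hta htb
    exact hab (Fin.ext (hta.symm.trans htb))
  · rw [Set.eq_univ_iff_forall]
    intro t
    exact Set.mem_iUnion.2 ⟨⟨N t, Nat.lt_succ_of_le (Finset.card_filter_le _ _)⟩, rfl⟩

/-- A nonempty connected set avoiding all pairwise intersections of a finite closed cover lies in
exactly one member of the cover. -/
theorem IsPreconnected.exists_subset_of_closed_cover {X ι : Type*} [TopologicalSpace X] [Finite ι]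
    {U : Set X} (hU : IsPreconnected U) (hne : U.Nonempty) {S : ι → Set X}
    (hS : ∀ i, IsClosed (S i)) (hcov : U ⊆ ⋃ i, S i)
    (hdisj : ∀ t ∈ U, ∀ i l, t ∈ S i → t ∈ S l → i = l) :
    ∃! i, U ⊆ S i ∧ ∀ l, l ≠ i → U ∩ S l = ∅ := by
  obtain ⟨t, ht⟩ := hne
  obtain ⟨i, hi⟩ := Set.mem_iUnion.1 (hcov ht)
  have hsub : U ⊆ S i := by
    refine (isPreconnected_iff_subset_of_disjoint_closed.1 hU (S i) (⋃ l : {l // l ≠ i}, S l) (hS i)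
      (isClosed_iUnion_of_finite fun l => hS l) ?_ ?_).resolve_right ?_
    · intro x hx
      obtain ⟨l, hl⟩ := Set.mem_iUnion.1 (hcov hx)
      by_cases h : l = i
      · exact Or.inl (h ▸ hl)
      · exact Or.inr (Set.mem_iUnion.2 ⟨⟨l, h⟩, hl⟩)
    · rw [Set.eq_empty_iff_forall_notMem]
      rintro x ⟨hx, hxi, hxl⟩
      obtain ⟨l, hl⟩ := Set.mem_iUnion.1 hxl
      exact l.2 (hdisj x hx _ _ hl hxi)
    · intro h
      obtain ⟨l, hl⟩ := Set.mem_iUnion.1 (h ht)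
      exact l.2 (hdisj t ht _ _ hl hi)
  refine ⟨i, ⟨hsub, fun l hl => ?_⟩, fun l hl => hdisj t ht _ _ (hl.1 ht) hi⟩
  rw [Set.eq_empty_iff_forall_notMem]
  rintro x ⟨hx, hxl⟩
  exact hl (hdisj x hx _ _ hxl (hsub hx))

theorem dotProduct_mulVec_line {d : ℕ} (B : Matrix (Fin d) (Fin d) ℝ) (v q : Fin d → ℝ) (t : ℝ) :
    (v + t • q) ⬝ᵥ B.mulVec (v + t • q) =
      (q ⬝ᵥ B.mulVec q) * t ^ 2 + (q ⬝ᵥ B.mulVec v + v ⬝ᵥ B.mulVec q) * t +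
        v ⬝ᵥ B.mulVec v := by
  simp only [Matrix.mulVec_add, Matrix.mulVec_smul, dotProduct_add, add_dotProduct,
    dotProduct_smul, smul_dotProduct, smul_eq_mul]
  ring

theorem statement16 {d k : ℕ} (hk : 0 < k) (c q : Fin d → ℝ) (hq : q ≠ 0)
    (s : Fin k → Fin d → ℝ) (σ : Fin k → ℝ)
    (A : Fin k → Matrix (Fin d) (Fin d) ℝ) (hA : ∀ i, (A i).PosDef)
    (g : Fin k → ℝ → ℝ)
    (hg : g = fun i t => (c + t • q - s i) ⬝ᵥ (A i).mulVec (c + t • q - s i) + σ i)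
    (hdist : ∀ i l, i ≠ l → g i ≠ g l)
    (S : Fin k → Set ℝ)
    (hS : S = fun i => {t : ℝ | ∀ l, g i t ≤ g l t}) :
    ∃ m : ℕ, m ≤ 2 * k - 1 ∧ ∃ I : Fin m → Set ℝ,
      (∀ a, (I a).Nonempty ∧ (I a).OrdConnected) ∧
      Pairwise (Function.onFun Disjoint I) ∧
      (⋃ a, I a) = Set.univ ∧
      ∀ a, ∃! i : Fin k, interior (I a) ⊆ S i ∧
        ∀ l, l ≠ i → interior (I a) ∩ S l = ∅ := by
  have hquad : ∀ i t, g i t = (q ⬝ᵥ (A i).mulVec q) * t ^ 2 +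
      (q ⬝ᵥ (A i).mulVec (c - s i) + (c - s i) ⬝ᵥ (A i).mulVec q) * t +
      ((c - s i) ⬝ᵥ (A i).mulVec (c - s i) + σ i) := by
    intro i t
    have hline : c + t • q - s i = (c - s i) + t • q := by abel
    simp only [hg]
    rw [hline, dotProduct_mulVec_line]
    ring
  have hcont : ∀ i, Continuous (g i) := by
    intro i
    rw [funext (hquad i)]
    fun_prop
  have hclosed : ∀ i, IsClosed (S i) := by
    intro i
    simp only [hS, Set.ofPred_forall]
    exact isClosed_iInter fun l => isClosed_le (hcont i) (hcont l)
  have hcov : ∀ t, t ∈ ⋃ i, S i := by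
    intro t
    have : Nonempty (Fin k) := ⟨⟨0, hk⟩⟩
    obtain ⟨i, hi⟩ := Finite.exists_min fun i => g i t
    exact Set.mem_iUnion.2 ⟨i, by simpa only [hS, Set.mem_ofPred_eq] using hi⟩
  have hcard := encard_tiePoints_le g _ _ _ hquad
    (fun i l h => by_contra fun hil => hdist i l hil h) Finset.univ
  rw [Finset.card_univ, Fintype.card_fin] at hcard
  have hfin : (tiePoints g Finset.univ).Finite :=
    Set.finite_of_encard_le_coe hcard
  rw [hfin.encard_eq_coe_toFinset_card, Nat.cast_le] at hcard
  obtain ⟨I, hI, hdisj, hunion⟩ := exists_interval_partition hfin.toFinset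
  refine ⟨_, by omega, I, fun a => ⟨(hI a).2.1.mono interior_subset, (hI a).1⟩, hdisj, hunion,
    fun a => ?_⟩
  obtain ⟨hconn, hne, hties⟩ := hI a
  refine IsPreconnected.exists_subset_of_closed_cover hconn.interior.isPreconnected hne hclosed
    (fun t _ => hcov t) fun t ht i l hi hl => ?_
  by_contra hil
  simp only [hS, Set.mem_ofPred_eq] at hi hl
  refine Set.disjoint_left.1 hties ht ?_
  rw [Set.Finite.coe_toFinset]
  exact ⟨i, Finset.mem_univ i, l, Finset.mem_univ l, hil, fun m _ => hi m, (hl i).antisymm (hi l)⟩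

end
end

section
/- Let (X̃,Ω̃) be a weighted data set in ℝ^d with points x̃_1,…,x̃_ñ, let C = (ξ_{ij}) ∈ C_K(k,X̃,Ω̃), and suppose there exist pairwise distinct sites t_1,…,t_k ∈ ℝ^d, sizes σ_1,…,σ_k ∈ ℝ, and symmetric positive definite matrices A_1,…,A_k with cells P_i = {x ∈ ℝ^d : ‖x−t_i‖_{A_i}² + σ_i ≤ ‖x−t_ℓ‖_{A_ℓ}² + σ_ℓ for all ℓ ∈ [k]} such that the diagram is strictly compatible with C, i.e., for every i ∈ [k] and j ∈ [ñ], ξ_{ij} > 0 if and only if x̃_j ∈ P_i, and for all i ≠ ℓ at most one data point lies in P_i ∩ P_ℓ. Then for every line L = {c + t·q : t ∈ ℝ} in ℝ^d (q ≠ 0) there exist m ≤ 2k − 1 and a partition of L into m nonempty intervals such that for each interval I there is an i ∈ [k] with ξ_{ij} = 1 for every j ∈ [ñ] with x̃_j in the relative interior of I. -/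
open Finset Matrix

noncomputable section

section LabelledPoints

variable {α ι : Type*} [LinearOrder α]

/-- A point of `T` at which a partition of the line has to be cut: it carries at least two labels,
or it follows a point with a single, different label. -/
def IsBreak (T : Finset α) (S : α → Finset ι) (u : α) : Prop :=
  1 < #(S u) ∨ ∃ v ∈ T, v < u ∧ (∀ w ∈ T, w < u → w ≤ v) ∧ #(S v) = 1 ∧ S v ≠ S u

/-- The first (`false`) or last (`true`) occurrence of a label accounts for the break at `u`. -/
def Charges (T : Finset α) (S : α → Finset ι) (u : α) : ι × Bool → Prop
  | (i, false) => i ∈ S u ∧ ∀ w ∈ T, i ∈ S w → u ≤ w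
  | (i, true) => ∃ p ∈ T, i ∈ S p ∧ (∀ w ∈ T, i ∈ S w → w ≤ p) ∧
      (p = u ∧ 1 < #(S u) ∨ #(S p) = 1 ∧ p < u ∧ ∀ w ∈ T, w < u → w ≤ p)

variable {T : Finset α} {S : α → Finset ι}

theorem Charges.eq_of_charges {u u' : α} (hu : u ∈ T) (hu' : u' ∈ T) {e : ι × Bool}
    (h : Charges T S u e) (h' : Charges T S u' e) : u = u' := by
  obtain ⟨i, _ | _⟩ := e
  · exact le_antisymm (h.2 u' hu' h'.1) (h'.2 u hu h.1)
  · obtain ⟨p, hp, hip, hlast, hpu⟩ := h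
    obtain ⟨p', hp', hip', hlast', hpu'⟩ := h'
    obtain rfl : p = p' := le_antisymm (hlast' p hp hip) (hlast p' hp' hip')
    rcases hpu with ⟨rfl, h1⟩ | ⟨h1, h2, h3⟩ <;> rcases hpu' with ⟨rfl, h1'⟩ | ⟨h1', h2', h3'⟩
    · rfl
    · omega
    · omega
    · rcases lt_trichotomy u u' with hlt | heq | hlt
      · exact absurd (h3' u hu hlt) (not_le.2 h2)
      · exact heq
      · exact absurd (h3 u' hu' hlt) (not_le.2 h2')

theorem IsBreak.exists_charges
    (hne : ∀ u ∈ T, (S u).Nonempty)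
    (hinter : ∀ u ∈ T, ∀ v ∈ T, ∀ a b, a ≠ b → a ∈ S u → a ∈ S v → b ∈ S u → b ∈ S v → u = v)
    (halt : ∀ a b, a ≠ b → ∀ u₁ ∈ T, ∀ u₂ ∈ T, ∀ u₃ ∈ T, ∀ u₄ ∈ T, u₁ < u₂ → u₂ < u₃ → u₃ < u₄ →
      a ∈ S u₁ → b ∈ S u₂ → a ∈ S u₃ → b ∈ S u₄ → False)
    {x y u : α} {i₀ i₁ : ι} (hx : x ∈ T) (hxmin : ∀ w ∈ T, x ≤ w) (hi₀ : i₀ ∈ S x)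
    (hy : y ∈ T) (hymax : ∀ w ∈ T, w ≤ y) (hi₁ : i₁ ∈ S y) (hu : u ∈ T) (h : IsBreak T S u) :
    ∃ e, Charges T S u e ∧ e ≠ (i₀, false) ∧ e ≠ (i₁, true) := by
  by_cases hmulti : 1 < #(S u)
  · rcases (hxmin u hu).eq_or_lt with rfl | hxu
    · obtain ⟨i, hi, hii⟩ := exists_mem_ne hmulti i₀
      exact ⟨(i, false), ⟨hi, fun w hw _ => hxmin w hw⟩, by simp [hii], by simp⟩
    rcases (hymax u hu).eq_or_lt with rfl | huy
    · obtain ⟨i, hi, hii⟩ := exists_mem_ne hmulti i₁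
      exact ⟨(i, true), ⟨u, hu, hi, fun w hw _ => hymax w hw, .inl ⟨rfl, hmulti⟩⟩, by simp,
        by simp [hii]⟩
    by_contra hcon
    have before : ∀ i ∈ S u, ∃ w ∈ T, w < u ∧ i ∈ S w := by
      intro i hi
      by_contra! hno
      refine hcon ⟨(i, false), ⟨hi, fun w hw hiw => ?_⟩, ?_, by simp⟩
      · exact not_lt.1 fun hwu => hno w hw hwu hiw
      · rintro ⟨⟩
        exact hno x hx hxu hi₀
    have after : ∀ i ∈ S u, ∃ w ∈ T, u < w ∧ i ∈ S w := by
      intro i hi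
      by_contra! hno
      refine hcon ⟨(i, true), ⟨u, hu, hi, fun w hw hiw => ?_, .inl ⟨rfl, hmulti⟩⟩, by simp, ?_⟩
      · exact not_lt.1 fun hwu => hno w hw hwu hiw
      · rintro ⟨⟩
        exact hno y hy huy hi₁
    obtain ⟨a, ha, b, hb, hab⟩ := one_lt_card.1 hmulti
    obtain ⟨p, hp, hpu, hap⟩ := before a ha
    obtain ⟨p', hp', hpu', hbp'⟩ := before b hb
    obtain ⟨r, hr, hur, har⟩ := after a ha
    obtain ⟨r', hr', hur', hbr'⟩ := after b hb
    rcases lt_trichotomy p p' with hlt | rfl | hlt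
    · rcases lt_trichotomy r r' with hlt' | rfl | hlt'
      · exact halt a b hab p hp p' hp' u hu r' hr' hlt hpu' hur' hap hbp' ha hbr'
      · exact hur.ne (hinter u hu r hr a b hab ha har hb hbr')
      · exact halt a b hab p hp p' hp' u hu r' hr' hlt hpu' hur' hap hbp' ha hbr'
    · exact hpu.ne (hinter p hp u hu a b hab hap ha hbp' hb)
    · exact halt b a hab.symm p' hp' p hp u hu r hr hlt hpu hur hbp' hap hb har
  · obtain ⟨v, hv, hvu, hpred, hcard, hvS⟩ := h.resolve_left hmulti
    obtain ⟨a, ha⟩ := card_eq_one.1 hcard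
    obtain ⟨b, hb⟩ := card_eq_one.1 (le_antisymm (not_lt.1 hmulti) (hne u hu).card_pos)
    have hab : a ≠ b := by
      rintro rfl
      exact hvS (ha.trans hb.symm)
    by_contra hcon
    have before : ∃ w ∈ T, w < u ∧ b ∈ S w := by
      by_contra! hno
      refine hcon ⟨(b, false), ⟨by simp [hb], fun w hw hiw => ?_⟩, ?_, by simp⟩
      · exact not_lt.1 fun hwu => hno w hw hwu hiw
      · rintro ⟨⟩
        exact hno x hx ((hxmin v hv).trans_lt hvu) hi₀
    have after : ∃ w ∈ T, v < w ∧ a ∈ S w := by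
      by_contra! hno
      refine hcon ⟨(a, true), ⟨v, hv, by simp [ha], fun w hw hiw => ?_,
        .inr ⟨hcard, hvu, hpred⟩⟩, by simp, ?_⟩
      · exact not_lt.1 fun hwu => hno w hw hwu hiw
      · rintro ⟨⟩
        exact hno y hy (hvu.trans_le (hymax u hu)) hi₁
    obtain ⟨w, hw, hwu, hbw⟩ := before
    obtain ⟨w', hw', hvw', haw'⟩ := after
    have hwv : w < v := (hpred w hw hwu).lt_of_ne (by rintro rfl; simp_all)
    have huw' : u < w' := (not_lt.1 fun hlt => not_le.2 hvw' (hpred w' hw' hlt)).lt_of_ne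
      (by rintro rfl; simp_all)
    exact halt b a hab.symm w hw v hv u hu w' hw' hwv hvu huw' hbw (by simp [ha]) (by simp [hb])
      haw'

open Classical in
theorem card_filter_isBreak_le [Fintype ι]
    (hne : ∀ u ∈ T, (S u).Nonempty)
    (hinter : ∀ u ∈ T, ∀ v ∈ T, ∀ a b, a ≠ b → a ∈ S u → a ∈ S v → b ∈ S u → b ∈ S v → u = v)
    (halt : ∀ a b, a ≠ b → ∀ u₁ ∈ T, ∀ u₂ ∈ T, ∀ u₃ ∈ T, ∀ u₄ ∈ T, u₁ < u₂ → u₂ < u₃ → u₃ < u₄ →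
      a ∈ S u₁ → b ∈ S u₂ → a ∈ S u₃ → b ∈ S u₄ → False) :
    #{u ∈ T | IsBreak T S u} ≤ 2 * Fintype.card ι - 2 := by
  rcases T.eq_empty_or_nonempty with rfl | hT
  · simp
  obtain ⟨i₀, hi₀⟩ := hne _ (T.min'_mem hT)
  obtain ⟨i₁, hi₁⟩ := hne _ (T.max'_mem hT)
  have key : ∀ u ∈ T, IsBreak T S u →
      ∃ e, Charges T S u e ∧ e ≠ (i₀, false) ∧ e ≠ (i₁, true) := fun u hu h =>
    h.exists_charges hne hinter halt (T.min'_mem hT) (T.min'_le) hi₀ (T.max'_mem hT) (T.le_max')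
      hi₁ hu
  have : Nonempty ι := ⟨i₀⟩
  choose! f hf using key
  have hcard : #((univ.erase (i₀, false)).erase (i₁, true)) = 2 * Fintype.card ι - 2 := by
    rw [card_erase_of_mem (by simp), card_erase_of_mem (by simp), card_univ, Fintype.card_prod,
      Fintype.card_bool, mul_comm, Nat.sub_sub]
  rw [← hcard]
  refine card_le_card_of_injOn f (fun u hu => ?_) fun u hu v hv huv => ?_
  · have := hf u (mem_filter.1 hu).1 (mem_filter.1 hu).2
    simp [this.2]
  · simp only [coe_filter, Set.mem_ofPred_eq] at hu hv
    exact (hf u hu.1 hu.2).1.eq_of_charges hu.1 hv.1 (huv ▸ (hf v hv.1 hv.2).1)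

theorem card_eq_one_of_not_isBreak {u : α} (h : ¬ IsBreak T S u) (hne : (S u).Nonempty) :
    #(S u) = 1 :=
  le_antisymm (not_lt.1 fun h' => h (.inl h')) hne.card_pos

open Classical in
theorem eq_of_forall_not_isBreak (hne : ∀ u ∈ T, (S u).Nonempty) {x y : α} (hx : x ∈ T)
    (hy : y ∈ T) (hxy : x ≤ y) (h : ∀ u ∈ T, x ≤ u → u ≤ y → ¬ IsBreak T S u) : S x = S y := by
  by_contra hS
  obtain ⟨u, hu, humin⟩ := ({w ∈ T | x ≤ w ∧ w ≤ y ∧ S x ≠ S w} : Finset α).exists_minimal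
    ⟨y, by simp [hy, hxy, hS]⟩
  obtain ⟨huT, hxu, huy, hSu⟩ := mem_filter.1 hu
  have hxu' : x < u := hxu.lt_of_ne (by rintro rfl; exact hSu rfl)
  obtain ⟨v, hv, hvmax⟩ := ({w ∈ T | w < u} : Finset α).exists_maximal ⟨x, by simp [hx, hxu']⟩
  obtain ⟨hvT, hvu⟩ := mem_filter.1 hv
  have hpred : ∀ w ∈ T, w < u → w ≤ v := fun w hw hwu =>
    (le_total w v).elim id fun hvw => hvmax (mem_filter.2 ⟨hw, hwu⟩) hvw
  have hxv : x ≤ v := hpred x hx hxu'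
  have hvy : v ≤ y := hvu.le.trans huy
  have hSv : S x = S v := by
    by_contra hne'
    exact not_le.2 hvu (humin (mem_filter.2 ⟨hvT, hxv, hvy, hne'⟩) hvu.le)
  exact h u huT hxu huy (.inr ⟨v, hvT, hvu, hpred,
    card_eq_one_of_not_isBreak (h v hvT hxv hvy) (hne v hvT), hSv ▸ hSu⟩)

end LabelledPoints

theorem exists_partition_interior_disjoint (B : Finset ℝ) :
    ∃ I : Fin (#B + 1) → Set ℝ, (∀ a, (I a).Nonempty ∧ (I a).OrdConnected) ∧
      Pairwise (Function.onFun Disjoint I) ∧ (⋃ a, I a) = Set.univ ∧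
      ∀ a, ∀ b ∈ B, b ∉ interior (I a) := by
  let f : ℝ → Fin (#B + 1) := fun τ => ⟨#{b ∈ B | b < τ}, Nat.lt_succ_of_le (card_filter_le _ _)⟩
  have hmono : Monotone f := fun x y hxy => Fin.mk_le_mk.2 <|
    card_le_card fun b hb => by
      rw [mem_filter] at hb ⊢
      exact ⟨hb.1, hb.2.trans_le hxy⟩
  refine ⟨fun a => f ⁻¹' {a}, fun a => ⟨?_, Set.ordConnected_singleton.preimage_mono hmono⟩,
    fun a b hab => Disjoint.preimage _ (Set.disjoint_singleton.2 hab), ?_, ?_⟩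
  · rcases (Nat.lt_succ_iff.1 a.2).lt_or_eq with ha | ha
    · refine ⟨B.orderEmbOfFin rfl ⟨a, ha⟩, Fin.ext ?_⟩
      have : ({b ∈ B | b < B.orderEmbOfFin rfl ⟨a, ha⟩} : Finset ℝ) =
          (Finset.Iio (⟨a, ha⟩ : Fin #B)).map (B.orderEmbOfFin rfl).toEmbedding := by
        ext b
        simp only [mem_filter, Finset.mem_map, Finset.mem_Iio, RelEmbedding.coe_toEmbedding]
        constructor
        · rintro ⟨hb, hlt⟩
          obtain ⟨i, rfl⟩ : b ∈ Set.range (B.orderEmbOfFin rfl) := by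
            rw [range_orderEmbOfFin]; exact hb
          exact ⟨i, (B.orderEmbOfFin rfl).lt_iff_lt.1 hlt, rfl⟩
        · rintro ⟨i, hi, rfl⟩
          exact ⟨orderEmbOfFin_mem _ _ _, (B.orderEmbOfFin rfl).lt_iff_lt.2 hi⟩
      simp [f, this]
    · obtain ⟨M, hM⟩ := B.bddAbove
      refine ⟨M + 1, Fin.ext ?_⟩
      simp only [f, ha]
      rw [filter_true_of_mem fun b hb => (hM hb).trans_lt (lt_add_one M)]
  · rw [← Set.preimage_iUnion, Set.iUnion_of_singleton, Set.preimage_univ]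
  · intro a b hb hba
    obtain ⟨ε, hε, hball⟩ := Metric.mem_nhds_iff.1 (mem_interior_iff_mem_nhds.1 hba)
    have h₁ : f b = a := interior_subset (s := f ⁻¹' {a}) hba
    have h₂ : f (b + ε / 2) = a := hball (by
      rw [Metric.mem_ball, Real.dist_eq, add_sub_cancel_left, abs_of_pos (half_pos hε)]
      exact half_lt_self hε)
    have hlt : #{b' ∈ B | b' < b} < #{b' ∈ B | b' < b + ε / 2} := by
      refine card_lt_card ((ssubset_iff_of_subset fun b' hb' => ?_).2 ⟨b, ?_, ?_⟩)
      · rw [mem_filter] at hb' ⊢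
        exact ⟨hb'.1, by linarith [hb'.2]⟩
      · simp [hb, hε]
      · simp
    exact hlt.ne (congrArg Fin.val (h₁.trans h₂.symm))

theorem quadratic_eq_zero_of_alternating {a b c x₁ x₂ x₃ x₄ : ℝ}
    (h₁₂ : x₁ < x₂) (h₂₃ : x₂ < x₃) (h₃₄ : x₃ < x₄)
    (h₁ : a * x₁ ^ 2 + b * x₁ + c ≤ 0) (h₂ : 0 ≤ a * x₂ ^ 2 + b * x₂ + c)
    (h₃ : a * x₃ ^ 2 + b * x₃ + c ≤ 0) (h₄ : 0 ≤ a * x₄ ^ 2 + b * x₄ + c) :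
    a * x₁ ^ 2 + b * x₁ + c = 0 ∧ a * x₂ ^ 2 + b * x₂ + c = 0 := by
  have d₁₂ := sub_pos.2 h₁₂
  have d₂₃ := sub_pos.2 h₂₃
  have d₃₄ := sub_pos.2 h₃₄
  have d₁₃ := sub_pos.2 (h₁₂.trans h₂₃)
  have d₂₄ := sub_pos.2 (h₂₃.trans h₃₄)
  have e : (a * x₁ ^ 2 + b * x₁ + c) * (x₃ - x₂) - (a * x₂ ^ 2 + b * x₂ + c) * (x₃ - x₁)
      + (a * x₃ ^ 2 + b * x₃ + c) * (x₂ - x₁) = a * ((x₂ - x₁) * (x₃ - x₂) * (x₃ - x₁)) := by ring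
  have e' : (a * x₂ ^ 2 + b * x₂ + c) * (x₄ - x₃) - (a * x₃ ^ 2 + b * x₃ + c) * (x₄ - x₂)
      + (a * x₄ ^ 2 + b * x₄ + c) * (x₃ - x₂) = a * ((x₃ - x₂) * (x₄ - x₃) * (x₄ - x₂)) := by ring
  have m₁ := mul_nonpos_of_nonpos_of_nonneg h₁ d₂₃.le
  have m₂ := mul_nonneg h₂ d₁₃.le
  have m₃ := mul_nonpos_of_nonpos_of_nonneg h₃ d₁₂.le
  have m₂' := mul_nonneg h₂ d₃₄.le
  have m₃' := mul_nonpos_of_nonpos_of_nonneg h₃ d₂₄.le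
  have m₄' := mul_nonneg h₄ d₂₃.le
  have ha : a ≤ 0 := by
    by_contra! ha
    have := mul_pos ha (mul_pos (mul_pos d₁₂ d₂₃) d₁₃)
    linarith
  have ha' : 0 ≤ a := by
    by_contra! ha'
    have := mul_neg_of_neg_of_pos ha' (mul_pos (mul_pos d₂₃ d₃₄) d₂₄)
    linarith
  obtain rfl := le_antisymm ha ha'
  rw [zero_mul] at e
  refine ⟨(mul_eq_zero.1 ?_).resolve_right d₂₃.ne', (mul_eq_zero.1 ?_).resolve_right d₁₃.ne'⟩ <;>
    linarith

theorem anormSq_add_smul {d : ℕ} (A : Matrix (Fin d) (Fin d) ℝ) (v q : Fin d → ℝ) (τ : ℝ) :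
    anormSq A (v + τ • q) = anormSq A q * τ ^ 2 + (v ⬝ᵥ A *ᵥ q + q ⬝ᵥ A *ᵥ v) * τ
      + anormSq A v := by
  simp only [anormSq, mulVec_add, mulVec_smul, dotProduct_add, add_dotProduct, smul_dotProduct,
    dotProduct_smul, smul_eq_mul]
  ring

theorem statement17 {d k n : ℕ} (hk : 0 < k)
    (κlo κhi : Fin k → ℝ)
    (x' : Fin n → Fin d → ℝ) (ω' : Fin n → ℝ) (hω' : ∀ j, 0 < ω' j)
    (ξ : Fin k → Fin n → ℝ) (hξ : IsWCC κlo κhi ω' ξ)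
    (t : Fin k → Fin d → ℝ) (ht : Function.Injective t)
    (σ : Fin k → ℝ)
    (A : Fin k → Matrix (Fin d) (Fin d) ℝ) (hA : ∀ i, (A i).PosDef)
    (P : Fin k → Set (Fin d → ℝ))
    (hP : P = fun i => {y : Fin d → ℝ |
      ∀ l, anormSq (A i) (y - t i) + σ i ≤ anormSq (A l) (y - t l) + σ l})
    (hcompat : ∀ i j, 0 < ξ i j ↔ x' j ∈ P i)
    (hstrict : ∀ i l, i ≠ l → {j : Fin n | x' j ∈ P i ∧ x' j ∈ P l}.Subsingleton)
    (c q : Fin d → ℝ) (hq : q ≠ 0) :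
    ∃ m : ℕ, m ≤ 2 * k - 1 ∧ ∃ I : Fin m → Set ℝ,
      (∀ a, (I a).Nonempty ∧ (I a).OrdConnected) ∧
      Pairwise (Function.onFun Disjoint I) ∧
      (⋃ a, I a) = Set.univ ∧
      ∀ a, ∃ i : Fin k, ∀ j : Fin n,
        (∃ τ ∈ interior (I a), x' j = c + τ • q) → ξ i j = 1 := by
  classical
  let S : ℝ → Finset (Fin k) := fun τ => {i | c + τ • q ∈ P i}
  have hS : ∀ {τ i}, i ∈ S τ ↔ c + τ • q ∈ P i := by simp [S]
  have hline : Function.Injective fun τ : ℝ => c + τ • q :=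
    (add_right_injective c).comp (smul_left_injective ℝ hq)
  have hfin : {τ : ℝ | ∃ j, x' j = c + τ • q}.Finite := by
    refine ((Set.finite_range x').preimage hline.injOn).subset ?_
    rintro τ ⟨j, hj⟩
    exact ⟨j, hj⟩
  let T : Finset ℝ := hfin.toFinset
  have hT : ∀ {τ}, τ ∈ T ↔ ∃ j, x' j = c + τ • q := by simp [T]
  have hne : ∀ τ ∈ T, (S τ).Nonempty := by
    intro τ hτ
    obtain ⟨j, hj⟩ := hT.1 hτ
    obtain ⟨i, -, hi⟩ := exists_lt_of_sum_lt (s := univ) (f := fun _ : Fin k => (0 : ℝ))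
      (g := fun i => ξ i j) (by simp [hξ.1.2 j])
    exact ⟨i, hS.2 (hj ▸ (hcompat i j).1 hi)⟩
  have hinter : ∀ u ∈ T, ∀ v ∈ T, ∀ a b, a ≠ b →
      a ∈ S u → a ∈ S v → b ∈ S u → b ∈ S v → u = v := by
    intro u hu v hv a b hab hau hav hbu hbv
    obtain ⟨j, hj⟩ := hT.1 hu
    obtain ⟨l, hl⟩ := hT.1 hv
    rw [hS, ← hj] at hau hbu
    rw [hS, ← hl] at hav hbv
    obtain rfl := hstrict a b hab ⟨hau, hbu⟩ ⟨hav, hbv⟩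
    exact hline (hj.symm.trans hl)
  let F : Fin k → ℝ → ℝ := fun i τ => anormSq (A i) (c + τ • q - t i) + σ i
  have hSF : ∀ {τ i}, i ∈ S τ ↔ ∀ l, F i τ ≤ F l τ := by
    intro τ i
    rw [hS, hP]
    rfl
  have hFsub : ∀ a b, ∃ α β γ : ℝ, ∀ τ, F a τ - F b τ = α * τ ^ 2 + β * τ + γ := by
    intro a b
    refine ⟨anormSq (A a) q - anormSq (A b) q,
      ((c - t a) ⬝ᵥ A a *ᵥ q + q ⬝ᵥ A a *ᵥ (c - t a))
        - ((c - t b) ⬝ᵥ A b *ᵥ q + q ⬝ᵥ A b *ᵥ (c - t b)),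
      anormSq (A a) (c - t a) + σ a - (anormSq (A b) (c - t b) + σ b), fun τ => ?_⟩
    simp only [F, add_sub_right_comm c, anormSq_add_smul]
    ring
  have halt : ∀ a b, a ≠ b → ∀ u₁ ∈ T, ∀ u₂ ∈ T, ∀ u₃ ∈ T, ∀ u₄ ∈ T, u₁ < u₂ → u₂ < u₃ →
      u₃ < u₄ → a ∈ S u₁ → b ∈ S u₂ → a ∈ S u₃ → b ∈ S u₄ → False := by
    intro a b hab u₁ hu₁ u₂ hu₂ u₃ _ u₄ _ h₁₂ h₂₃ h₃₄ h₁ h₂ h₃ h₄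
    obtain ⟨α, β, γ, hquad⟩ := hFsub a b
    obtain ⟨e₁, e₂⟩ := quadratic_eq_zero_of_alternating h₁₂ h₂₃ h₃₄
      (hquad u₁ ▸ sub_nonpos.2 (hSF.1 h₁ b)) (hquad u₂ ▸ sub_nonneg.2 (hSF.1 h₂ a))
      (hquad u₃ ▸ sub_nonpos.2 (hSF.1 h₃ b)) (hquad u₄ ▸ sub_nonneg.2 (hSF.1 h₄ a))
    rw [← hquad, sub_eq_zero] at e₁ e₂
    exact h₁₂.ne (hinter u₁ hu₁ u₂ hu₂ a b hab h₁ (hSF.2 fun l => e₂ ▸ hSF.1 h₂ l)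
      (hSF.2 fun l => e₁ ▸ hSF.1 h₁ l) h₂)
  have hcard := card_filter_isBreak_le hne hinter halt
  rw [Fintype.card_fin] at hcard
  obtain ⟨I, hI, hdisj, hunion, hint⟩ :=
    exists_partition_interior_disjoint {u ∈ T | IsBreak T S u}
  refine ⟨_, by omega, I, hI, hdisj, hunion, fun a => ?_⟩
  have hnobreak : ∀ u ∈ T, u ∈ interior (I a) → ¬ IsBreak T S u := fun u hu hua hb =>
    hint a u (mem_filter.2 ⟨hu, hb⟩) hua
  have hconn : (interior (I a)).OrdConnected := (hI a).2.interior
  have heq : ∀ u ∈ T, ∀ v ∈ T, u ∈ interior (I a) → v ∈ interior (I a) → S u = S v := by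
    intro u hu v hv hua hva
    rcases le_total u v with huv | hvu
    · exact eq_of_forall_not_isBreak hne hu hv huv fun w hw h h' =>
        hnobreak w hw (hconn.out hua hva ⟨h, h'⟩)
    · exact (eq_of_forall_not_isBreak hne hv hu hvu fun w hw h h' =>
        hnobreak w hw (hconn.out hva hua ⟨h, h'⟩)).symm
  by_cases hex : ∃ u ∈ T, u ∈ interior (I a)
  · obtain ⟨u, hu, hua⟩ := hex
    obtain ⟨i, hi⟩ := card_eq_one.1 (card_eq_one_of_not_isBreak (hnobreak u hu hua) (hne u hu))
    refine ⟨i, fun j ⟨τ, hτ, hj⟩ => ?_⟩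
    have hSτ : S τ = {i} := (heq τ (hT.2 ⟨j, hj⟩) u hu hτ hua).trans hi
    rw [← hξ.1.2 j, eq_comm]
    refine sum_eq_single i (fun l _ hl => le_antisymm (not_lt.1 fun hpos => hl ?_) (hξ.1.1 l j))
      (by simp)
    have : l ∈ S τ := hS.2 (hj ▸ (hcompat l j).1 hpos)
    rwa [hSτ, mem_singleton] at this
  · exact ⟨⟨0, hk⟩, fun j ⟨τ, hτ, hj⟩ => absurd ⟨τ, hT.2 ⟨j, hj⟩, hτ⟩ hex⟩

end
end

section
/- Let (X̄,Ω) be a weighted data set in ℝ^d with n points, let p : [n] → [ñ] be a merging function whose fibers are the batches B_1,…,B_ñ (B_j̃ = {x̄_j : p(j) = j̃}), and let the merged weighted data set (X_B,Ω_B) have points x_{j̃} equal to the centroid of batch B_j̃ and weights ω_{j̃} equal to the total weight of B_j̃. Let A = (A_1,…,A_k) be symmetric positive definite matrices, K weight bounds, S a k-tuple of sites, C_B ∈ C_K(k,X_B,Ω_B), and let f₂ be the extension of p. Then cost_{A,K}(X̄, f₂(C_B), S) ≤ cost_{A,K}(X_B, C_B, S) + λ^+(A)·Σ_{j̃=1}^{ñ}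 V_E(B_j̃). -/
open Finset Matrix

noncomputable section

/-- Expansion of the squared anisotropic norm of a sum. -/
theorem anormSq_add {d : ℕ} (A : Matrix (Fin d) (Fin d) ℝ) (u v : Fin d → ℝ) :
    anormSq A (u + v) = anormSq A u + (u ⬝ᵥ A.mulVec v + A.vecMul v ⬝ᵥ u) + anormSq A v := by
  simp only [anormSq, Matrix.mulVec_add, dotProduct_add, add_dotProduct,
    ← Matrix.dotProduct_mulVec]
  ring

/-- Parallel axis theorem: the weighted squared distances to `y` split at a weighted centroid `c`. -/
theorem sum_mul_anormSq_sub {ι : Type*} {d : ℕ} (A : Matrix (Fin d) (Fin d) ℝ) (t : Finset ι)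
    (w : ι → ℝ) (x : ι → Fin d → ℝ) (c y : Fin d → ℝ) (hc : ∑ j ∈ t, w j • (x j - c) = 0) :
    ∑ j ∈ t, w j * anormSq A (x j - y) =
      ∑ j ∈ t, w j * anormSq A (x j - c) + (∑ j ∈ t, w j) * anormSq A (c - y) := by
  have h₁ : ∑ j ∈ t, w j * ((x j - c) ⬝ᵥ A.mulVec (c - y)) = 0 := by
    simp only [← smul_eq_mul, ← smul_dotProduct, ← sum_dotProduct, hc, zero_dotProduct]
  have h₂ : ∑ j ∈ t, w j * (A.vecMul (c - y) ⬝ᵥ (x j - c)) = 0 := by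
    simp only [← smul_eq_mul, ← dotProduct_smul, ← dotProduct_sum, hc, dotProduct_zero]
  have h (j : ι) : x j - y = (x j - c) + (c - y) := by abel
  simp only [h, anormSq_add, mul_add, sum_add_distrib, h₁, h₂, sum_mul, add_zero]

/-- Weighted deviations from the weighted centroid sum to zero. -/
theorem sum_smul_sub_centroid {ι E : Type*} [AddCommGroup E] [Module ℝ E] (t : Finset ι)
    (w : ι → ℝ) (x : ι → E) (hw : ∑ j ∈ t, w j ≠ 0) :
    ∑ j ∈ t, w j • (x j - (∑ j ∈ t, w j)⁻¹ • ∑ j ∈ t, w j • x j) = 0 := by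
  simp only [smul_sub, sum_sub_distrib, ← sum_smul, smul_inv_smul₀ hw, sub_self]

theorem statement18 {d k n m : ℕ}
    (A : Fin k → Matrix (Fin d) (Fin d) ℝ) (hA : ∀ i, (A i).PosDef)
    (κlo κhi : Fin k → ℝ)
    (xb : Fin n → Fin d → ℝ) (ω : Fin n → ℝ) (hω : ∀ j, 0 < ω j)
    (p : Fin n → Fin m) (hp : Function.Surjective p)
    (ωB : Fin m → ℝ) (hωB : ωB = fun j' => ∑ j ∈ univ.filter (fun j => p j = j'), ω j)
    (xB : Fin m → Fin d → ℝ)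
    (hxB : xB = fun j' => (ωB j')⁻¹ • ∑ j ∈ univ.filter (fun j => p j = j'), ω j • xb j)
    (lp : ℝ) (hup : ∀ i (u : Fin d → ℝ), anormSq (A i) u ≤ lp * (u ⬝ᵥ u))
    (ξB : Fin k → Fin m → ℝ) (hξB : IsWCC κlo κhi ωB ξB)
    (s : Fin k → Fin d → ℝ)
    (V : Fin m → ℝ)
    (hV : V = fun j' => ∑ j ∈ univ.filter (fun j => p j = j'),
      ω j * ((xb j - xB j') ⬝ᵥ (xb j - xB j'))) :
    cost A xb ω (fun i j => ξB i (p j)) s ≤ cost A xB ωB ξB s + lp * ∑ j', V j' := by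
  have hsum (j' : Fin m) : ∑ j ∈ univ.filter (fun j => p j = j'), ω j ≠ 0 := by
    obtain ⟨j, hj⟩ := hp j'
    exact (sum_pos (fun j _ => hω j) ⟨j, by simp [hj]⟩).ne'
  have hcost : cost A xb ω (fun i j => ξB i (p j)) s =
      cost A xB ωB ξB s + ∑ i, ∑ j, ξB i (p j) * (ω j * anormSq (A i) (xb j - xB (p j))) := by
    simp only [cost, ← sum_add_distrib]
    refine sum_congr rfl fun i _ => ?_
    rw [← sum_fiberwise univ p, ← sum_fiberwise univ p
      (fun j => ξB i (p j) * (ω j * anormSq (A i) (xb j - xB (p j)))), ← sum_add_distrib]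
    refine sum_congr rfl fun j' _ => ?_
    have hc : ∑ j ∈ univ.filter (fun j => p j = j'), ω j • (xb j - xB j') = 0 := by
      simpa only [hxB, hωB] using sum_smul_sub_centroid _ ω xb (hsum j')
    have hsplit := sum_mul_anormSq_sub (A i) _ ω xb (xB j') (s i) hc
    have hfib (f : Fin m → Fin n → ℝ) :
        ∑ j ∈ univ.filter (fun j => p j = j'), ξB i (p j) * f (p j) j =
          ξB i j' * ∑ j ∈ univ.filter (fun j => p j = j'), f j' j := by
      rw [mul_sum]
      exact sum_congr rfl fun j hj => by rw [(mem_filter.mp hj).2]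
    simp only [mul_assoc]
    rw [hfib fun _ j => ω j * anormSq (A i) (xb j - s i),
      hfib fun j' j => ω j * anormSq (A i) (xb j - xB j'), hsplit, hωB]
    ring
  have hV' : ∑ j', V j' = ∑ j, ω j * ((xb j - xB (p j)) ⬝ᵥ (xb j - xB (p j))) := by
    rw [hV, ← sum_fiberwise univ p]
    exact sum_congr rfl fun j' _ => sum_congr rfl fun j hj => by rw [(mem_filter.mp hj).2]
  rw [hcost, hV', sum_comm, mul_sum]
  gcongr with j
  calc ∑ i, ξB i (p j) * (ω j * anormSq (A i) (xb j - xB (p j)))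
      ≤ ∑ i, ξB i (p j) * (ω j * (lp * ((xb j - xB (p j)) ⬝ᵥ (xb j - xB (p j))))) := by
        gcongr with i
        · exact hξB.1.1 i (p j)
        · exact (hω j).le
        · exact hup i _
    _ = lp * (ω j * ((xb j - xB (p j)) ⬝ᵥ (xb j - xB (p j)))) := by
        rw [← sum_mul, hξB.1.2 (p j)]
        ring

end
end
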